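/- arXiv:1305.2520 — 2 statements merged into one kernel-verified Lean document; each statement's English description precedes it below -/
import Mathlib

section
/- Let W(s) = (ζ'/ζ)'(s) be the derivative of the logarithmic derivative of the Riemann zeta function. For every integer k ≥ 0 and every complex number s with s ≠ 1, ζ(s) ≠ 0, and s not a trivial zero of ζ, the k-th derivative of W satisfies W^{(k)}(s) = (−1)^k (k+1)!·( 1/(s−1)^{k+2} − ∑*_ρ 1/(s−ρ)^{k+2} ), where ∑*_ρ runs over ALL zeros of ζ — the trivial zeros ρ = −2, −4, −6, … and the nontrivial zeros counted with multiplicity. -/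
open Complex

/-- The multiplicity (order of vanishing) of `f` at `ρ`: the largest `n` such that
`f z = (z - ρ)^n g z` near `ρ` for some function `g` analytic at `ρ`.  It is `0` when
`f ρ ≠ 0`, and also (junk value) at poles of `f`. -/
noncomputable def zeroMult (f : ℂ → ℂ) (ρ : ℂ) : ℕ :=
  sSup {n : ℕ | ∃ g : ℂ → ℂ, AnalyticAt ℂ g ρ ∧ ∀ᶠ z in nhds ρ, f z = (z - ρ) ^ n * g z}

/-- `W = (ζ'/ζ)'`, the derivative of the logarithmic derivative of the Riemann zeta function. -/
noncomputable def zetaLogDerivDeriv : ℂ → ℂ :=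
  deriv (fun z => deriv riemannZeta z / riemannZeta z)

/-- `s` is a trivial zero of `ζ`, i.e. a negative even integer. -/
def IsTrivialZetaZero (s : ℂ) : Prop := ∃ n : ℕ, s = -2 * (n + 1)

open Filter Topology Metric

lemma analyticOrderAt_ne_top_of_differentiable {F : ℂ → ℂ} (hF : Differentiable ℂ F)
    {z₀ : ℂ} (h0 : F z₀ ≠ 0) (z : ℂ) : analyticOrderAt F z ≠ ⊤ := by
  intro h
  have := AnalyticOnNhd.eq_of_eventuallyEq (f := F) (g := 0) (z₀ := z)
    (fun w _ => hF.analyticAt w) (fun w _ => analyticAt_const) (analyticOrderAt_eq_top.1 h)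
  exact h0 (by simp [this])

lemma finite_zeros_closedBall {F : ℂ → ℂ} (hF : Differentiable ℂ F) {z₀ : ℂ} (h0 : F z₀ ≠ 0)
    (R : ℝ) : (closedBall (0 : ℂ) R ∩ {z | F z = 0}).Finite := by
  have hcod := (show AnalyticOnNhd ℂ F Set.univ from
    fun w _ => hF.analyticAt w).preimage_zero_mem_codiscreteWithin (x := z₀) h0
      (Set.mem_univ _) isConnected_univ
  have hd := (mem_codiscrete'.1 hcod).2
  have hcl : IsClosed {z | F z = 0} := isClosed_eq hF.continuous continuous_const
  refine ((isCompact_closedBall (0 : ℂ) R).inter_right hcl).finite ?_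
  refine IsDiscrete.mono hd ?_
  rintro z ⟨-, hz⟩
  simpa using hz

lemma exists_factor_pow {F : ℂ → ℂ} (hF : Differentiable ℂ F) {ρ : ℂ}
    (h : analyticOrderAt F ρ ≠ ⊤) :
    ∃ g : ℂ → ℂ, Differentiable ℂ g ∧ g ρ ≠ 0 ∧
      ∀ z, F z = (z - ρ) ^ analyticOrderNatAt F ρ * g z := by
  obtain ⟨q, hq, hq0, hFq⟩ := (hF.analyticAt ρ).analyticOrderAt_ne_top.1 h
  classical
  set m := analyticOrderNatAt F ρ
  let g : ℂ → ℂ := fun z => if z = ρ then q ρ else F z / (z - ρ) ^ m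
  have hgq : g =ᶠ[𝓝 ρ] q := by
    filter_upwards [hFq] with z hz
    by_cases hzρ : z = ρ
    · simp [g, hzρ]
    · have : (z - ρ) ^ m ≠ 0 := pow_ne_zero _ (sub_ne_zero.2 hzρ)
      simp only [g, if_neg hzρ, hz, smul_eq_mul]
      field_simp
  refine ⟨g, fun z => ?_, by simpa [g] using hq0, fun z => ?_⟩
  · by_cases hzρ : z = ρ
    · subst hzρ
      exact hq.differentiableAt.congr_of_eventuallyEq hgq
    · have : (fun w => F w / (w - ρ) ^ m) =ᶠ[𝓝 z] g := by
        filter_upwards [isOpen_ne.mem_nhds hzρ] with w hw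
        simp only [g, if_neg hw]
      refine DifferentiableAt.congr_of_eventuallyEq ?_ this.symm
      exact (hF z).div (by fun_prop) (pow_ne_zero _ (sub_ne_zero.2 hzρ))
  · by_cases hzρ : z = ρ
    · subst hzρ
      simpa [g] using hFq.self_of_nhds
    · have : (z - ρ) ^ m ≠ 0 := pow_ne_zero _ (sub_ne_zero.2 hzρ)
      simp only [g, if_neg hzρ]
      field_simp

lemma exists_factor_prod {F : ℂ → ℂ} (hF : Differentiable ℂ F)
    (h : ∀ z, analyticOrderAt F z ≠ ⊤) (S : Finset ℂ) :
    ∃ g : ℂ → ℂ, Differentiable ℂ g ∧ (∀ ρ ∈ S, g ρ ≠ 0) ∧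
      ∀ z, F z = (∏ ρ ∈ S, (z - ρ) ^ analyticOrderNatAt F ρ) * g z := by
  induction S using Finset.cons_induction with
  | empty => exact ⟨F, hF, by simp, by simp⟩
  | cons a S ha ih =>
    obtain ⟨g, hg, hgS, hFg⟩ := ih
    set P : ℂ → ℂ := fun z => ∏ ρ ∈ S, (z - ρ) ^ analyticOrderNatAt F ρ with hP
    have hPa : AnalyticAt ℂ P a := by
      have : Differentiable ℂ P := by fun_prop
      exact this.analyticAt a
    have hPa0 : P a ≠ 0 := Finset.prod_ne_zero_iff.2 fun ρ hρ =>
      pow_ne_zero _ (sub_ne_zero.2 fun h => ha (h ▸ hρ))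
    have hord : analyticOrderAt F a = analyticOrderAt g a := by
      have : F = P * g := funext hFg
      rw [this, analyticOrderAt_mul hPa (hg.analyticAt a), hPa.analyticOrderAt_eq_zero.2 hPa0,
        zero_add]
    obtain ⟨q, hq, hqa, hgq⟩ := exists_factor_pow hg (hord ▸ h a)
    have hnat : analyticOrderNatAt g a = analyticOrderNatAt F a := by
      simp [analyticOrderNatAt, hord]
    refine ⟨q, hq, fun ρ hρ => ?_, fun z => ?_⟩
    · rcases Finset.mem_cons.1 hρ with rfl | hρ
      · exact hqa
      · intro h0
        exact hgS ρ hρ (by rw [hgq, h0, mul_zero])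
    · rw [hFg z, Finset.prod_cons, hgq z, hnat]
      ring

lemma exists_factor_normalized {F : ℂ → ℂ} (hF : Differentiable ℂ F)
    (h0 : F 0 ≠ 0) (S : Finset ℂ) (hS : 0 ∉ S) :
    ∃ g : ℂ → ℂ, Differentiable ℂ g ∧ (∀ ρ ∈ S, g ρ ≠ 0) ∧
      ∀ z, F z = (∏ ρ ∈ S, (1 - z / ρ) ^ analyticOrderNatAt F ρ) * g z := by
  obtain ⟨g, hg, hgS, hFg⟩ :=
    exists_factor_prod hF (analyticOrderAt_ne_top_of_differentiable hF h0) S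
  have hne : ∀ ρ ∈ S, ρ ≠ 0 := fun ρ hρ h => hS (h ▸ hρ)
  refine ⟨fun z => (∏ ρ ∈ S, (-ρ) ^ analyticOrderNatAt F ρ) * g z, by fun_prop,
    fun ρ hρ => mul_ne_zero (Finset.prod_ne_zero_iff.2 fun σ hσ =>
      pow_ne_zero _ (neg_ne_zero.2 (hne σ hσ))) (hgS ρ hρ), fun z => ?_⟩
  rw [hFg, ← mul_assoc, ← Finset.prod_mul_distrib]
  congr 1
  refine Finset.prod_congr rfl fun ρ hρ => ?_
  rw [← mul_pow]
  congr 1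
  have := hne ρ hρ
  field_simp
  ring

open Classical in
/-- The finset of zeros of an entire function in the closed disc of radius `R`. -/
noncomputable def zerosIn (F : ℂ → ℂ) (R : ℝ) : Finset ℂ :=
  if h : (closedBall (0 : ℂ) R ∩ {z | F z = 0}).Finite then h.toFinset else ∅

lemma mem_zerosIn {F : ℂ → ℂ} (hF : Differentiable ℂ F) (h0 : F 0 ≠ 0) {R : ℝ} {z : ℂ} :
    z ∈ zerosIn F R ↔ ‖z‖ ≤ R ∧ F z = 0 := by
  simp [zerosIn, dif_pos (finite_zeros_closedBall hF h0 R)]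

lemma exists_factor_bound {F : ℂ → ℂ} (hF : Differentiable ℂ F) (h0 : F 0 ≠ 0) {R M : ℝ}
    (hR : 0 < R) (hM : ∀ z, ‖z‖ ≤ 4 * R → ‖F z‖ ≤ M) :
    ∃ g : ℂ → ℂ, Differentiable ℂ g ∧ g 0 = F 0 ∧ (∀ z, ‖z‖ ≤ R → g z ≠ 0) ∧
      (∀ z, F z = (∏ ρ ∈ zerosIn F R, (1 - z / ρ) ^ analyticOrderNatAt F ρ) * g z) ∧
      ∀ z, ‖z‖ ≤ 4 * R →
        ‖g z‖ ≤ M / 3 ^ (∑ ρ ∈ zerosIn F R, analyticOrderNatAt F ρ) := by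
  have hS : (0 : ℂ) ∉ zerosIn F R := fun h => h0 ((mem_zerosIn hF h0).1 h).2
  obtain ⟨g, hg, hgS, hFg⟩ := exists_factor_normalized hF h0 (zerosIn F R) hS
  refine ⟨g, hg, ?_, fun z hz hgz => ?_, hFg, fun z hz => ?_⟩
  · simpa using (hFg 0).symm
  · exact hgS z ((mem_zerosIn hF h0).2 ⟨hz, by rw [hFg, hgz, mul_zero]⟩) hgz
  · refine norm_le_of_forall_mem_frontier_norm_le (U := ball (0 : ℂ) (4 * R)) isBounded_ball
      hg.diffContOnCl (fun w hw => ?_) ?_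
    · rw [frontier_ball _ (by positivity), mem_sphere_zero_iff_norm] at hw
      rw [le_div_iff₀ (by positivity)]
      refine le_trans ?_ (hM w hw.le)
      rw [hFg w, norm_mul, mul_comm, norm_prod, ← Finset.prod_pow_eq_pow_sum]
      gcongr with ρ hρ
      rw [norm_pow]
      gcongr
      have h1 := (mem_zerosIn hF h0).1 hρ
      have hρ0 : 0 < ‖ρ‖ := norm_pos_iff.2 fun h => hS (h ▸ hρ)
      have h2 : 4 ≤ ‖w / ρ‖ := by
        rw [norm_div, hw, le_div_iff₀ hρ0]; linarith [h1.1]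
      have := norm_sub_norm_le (w / ρ) 1
      rw [norm_sub_rev] at this
      simp at this h2 ⊢
      linarith
    · rw [closure_ball _ (by positivity)]; simpa using hz

lemma exists_log_of_ne_zero {g : ℂ → ℂ} {R : ℝ} (hR : 0 < R) (hg : Differentiable ℂ g)
    (hg0 : ∀ z ∈ ball (0 : ℂ) R, g z ≠ 0) :
    ∃ h : ℂ → ℂ, h 0 = 0 ∧ (∀ z ∈ ball (0 : ℂ) R, HasDerivAt h (deriv g z / g z) z) ∧
      ∀ z ∈ ball (0 : ℂ) R, exp (h z) = g z / g 0 := by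
  have hd : DifferentiableOn ℂ (fun z => deriv g z / g z) (ball 0 R) := fun z hz =>
    ((hg.contDiff (n := 2)).differentiable_deriv_two z).differentiableWithinAt.div
      (hg z).differentiableWithinAt (hg0 z hz)
  obtain ⟨h, hh⟩ := hd.isExactOn_ball
  have h0 : (0 : ℂ) ∈ ball (0 : ℂ) R := mem_ball_self hR
  refine ⟨fun z => h z - h 0, by simp, fun z hz => (hh z hz).sub_const _, fun z hz => ?_⟩
  have hder : ∀ w ∈ ball (0 : ℂ) R,
      HasDerivAt (fun z => g z * exp (-(h z))) 0 w := fun w hw => by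
    have := (hg w).hasDerivAt.mul (hh w hw).neg.cexp
    refine this.congr_deriv ?_
    have := hg0 w hw
    field_simp
    ring
  have hc := isOpen_ball.is_const_of_deriv_eq_zero (convex_ball (0 : ℂ) R).isPreconnected
    (fun w hw => (hder w hw).differentiableAt.differentiableWithinAt)
    (fun w hw => (hder w hw).deriv) hz h0
  have hg00 := hg0 0 h0
  simp only [Complex.exp_neg] at hc
  rw [Complex.exp_sub]
  have e1 := Complex.exp_ne_zero (h z)
  have e2 := Complex.exp_ne_zero (h 0)
  field_simp at hc ⊢
  linear_combination -hc

/-- For `g` entire without zeros in `ball 0 R` and bounded there by `exp M * ‖g 0‖`, the higher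
derivatives of `g' / g` are small well inside the disc. -/
lemma norm_iteratedDeriv_logDeriv_le {g : ℂ → ℂ} {R M : ℝ} (hR : 0 < R) (hM : 0 < M)
    (hg : Differentiable ℂ g) (hg0 : ∀ z ∈ ball (0 : ℂ) R, g z ≠ 0)
    (hgM : ∀ z ∈ ball (0 : ℂ) R, ‖g z‖ ≤ Real.exp M * ‖g 0‖) {s : ℂ} (hs : ‖s‖ ≤ R / 4) (n : ℕ) :
    ‖iteratedDeriv n (logDeriv g) s‖ ≤ (n + 1).factorial * (2 * M) / (R / 4) ^ (n + 1) := by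
  obtain ⟨h, h0, hd, he⟩ := exists_log_of_ne_zero hR hg hg0
  have hg00 := hg0 0 (mem_ball_self hR)
  have hsR : s ∈ ball (0 : ℂ) R := by rw [mem_ball_zero_iff]; linarith
  have hev : logDeriv g =ᶠ[𝓝 s] deriv h := by
    filter_upwards [isOpen_ball.mem_nhds hsR] with z hz
    rw [(hd z hz).deriv, logDeriv_apply]
  rw [hev.iteratedDeriv_eq, ← iteratedDeriv_succ']
  have hdiff : DifferentiableOn ℂ h (ball 0 R) := fun z hz =>
    (hd z hz).differentiableAt.differentiableWithinAt
  have hsub : closedBall s (R / 4) ⊆ ball (0 : ℂ) R := fun z hz => by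
    rw [mem_closedBall, dist_eq_norm] at hz
    rw [mem_ball_zero_iff]
    have := norm_add_le (z - s) s
    rw [sub_add_cancel] at this
    linarith
  refine norm_iteratedDeriv_le_of_forall_mem_sphere_norm_le (n + 1) (by positivity)
    ((hdiff.mono hsub).diffContOnCl_ball subset_rfl) fun z hz => ?_
  rw [mem_sphere, dist_eq_norm] at hz
  have hz2 : ‖z‖ ≤ R / 2 := by
    have := norm_add_le (z - s) s
    rw [sub_add_cancel] at this
    linarith
  have hre : Set.MapsTo h (ball 0 R) {z | z.re ≤ M} := fun w hw => by
    have h1 : ‖exp (h w)‖ ≤ Real.exp M := by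
      rw [he w hw, norm_div, div_le_iff₀ (norm_pos_iff.2 hg00)]
      exact hgM w hw
    rw [norm_exp] at h1
    exact Real.exp_le_exp.1 h1
  refine (borelCaratheodory_zero hM hdiff hre hR (z := z)
    (by rw [mem_ball_zero_iff]; linarith) h0).trans ?_
  rw [div_le_iff₀ (by linarith)]
  nlinarith

/-- `F` has growth order at most `3 / 2`, tested on the discs of radius `4 ^ j`. -/
def HasGrowth (F : ℂ → ℂ) (C : ℝ) : Prop :=
  ∀ (j : ℕ) (z : ℂ), ‖z‖ ≤ 4 ^ j → ‖F z‖ ≤ Real.exp (C * 8 ^ j)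

lemma HasGrowth.exists_factor {F : ℂ → ℂ} {C : ℝ} (hC : HasGrowth F C)
    (hF : Differentiable ℂ F) (h0 : F 0 ≠ 0) :
    ∃ K : ℝ, 0 < K ∧ ∀ j : ℕ, (∑ ρ ∈ zerosIn F (4 ^ j), (analyticOrderNatAt F ρ : ℝ) ≤ K * 8 ^ j) ∧
      ∃ g : ℂ → ℂ, Differentiable ℂ g ∧ g 0 = F 0 ∧
        (∀ z ∈ ball (0 : ℂ) (4 ^ j), g z ≠ 0) ∧
        (∀ z, F z = (∏ ρ ∈ zerosIn F (4 ^ j), (1 - z / ρ) ^ analyticOrderNatAt F ρ) * g z) ∧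
        ∀ z ∈ ball (0 : ℂ) (4 ^ j), ‖g z‖ ≤ Real.exp (K * 8 ^ j) * ‖g 0‖ := by
  have hF0 : 0 < ‖F 0‖ := norm_pos_iff.2 h0
  refine ⟨8 * |C| + |Real.log ‖F 0‖| + 1, by positivity, fun j => ?_⟩
  set K := 8 * |C| + |Real.log ‖F 0‖| + 1
  have hR : (0 : ℝ) < 4 ^ j := by positivity
  obtain ⟨g, hg, hg0, hgR, hFg, hgM⟩ := exists_factor_bound hF h0 hR
    (M := Real.exp (C * 8 ^ (j + 1))) (fun z hz => hC (j + 1) z (by rw [pow_succ]; linarith))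
  have h8 : (1 : ℝ) ≤ 8 ^ j := one_le_pow₀ (by norm_num)
  have hexp : Real.exp (C * 8 ^ (j + 1)) ≤ Real.exp (K * 8 ^ j) * ‖F 0‖ := by
    rw [show Real.exp (K * 8 ^ j) * ‖F 0‖ = Real.exp (K * 8 ^ j + Real.log ‖F 0‖) by
      rw [Real.exp_add, Real.exp_log hF0], Real.exp_le_exp, pow_succ]
    have h1 : C ≤ |C| := le_abs_self C
    have h2 : -|Real.log ‖F 0‖| ≤ Real.log ‖F 0‖ := neg_abs_le _
    have h3 : 0 ≤ |Real.log ‖F 0‖| := abs_nonneg _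
    simp only [K]
    nlinarith
  set N := ∑ ρ ∈ zerosIn F (4 ^ j), analyticOrderNatAt F ρ with hN
  have h3N : (1 : ℝ) ≤ 3 ^ N := one_le_pow₀ (by norm_num)
  refine ⟨?_, g, hg, hg0, fun z hz => hgR z (mem_ball_zero_iff.1 hz).le, hFg, fun z hz => ?_⟩
  · have h1 := hgM 0 (by simp)
    rw [hg0, le_div_iff₀ (by positivity)] at h1
    have h2 : (3 : ℝ) ^ N ≤ Real.exp (K * 8 ^ j) := by
      have := h1.trans hexp
      rw [mul_comm] at this
      exact le_of_mul_le_mul_right this hF0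
    have h3 : Real.exp (N : ℝ) ≤ 3 ^ N := by
      rw [← Real.exp_one_pow]
      gcongr
      exact Real.exp_one_lt_three.le
    have h4 := Real.exp_le_exp.1 (h3.trans h2)
    rw [hN] at h4
    exact_mod_cast h4
  · rw [hg0]
    refine (hgM z ?_).trans ((div_le_self (Real.exp_pos _).le h3N).trans hexp)
    have := mem_ball_zero_iff.1 hz
    linarith

lemma exists_nat_shell (r : ℝ) : ∃ j : ℕ, r ≤ 4 ^ j ∧ (4 : ℝ) ^ j ≤ 4 * (1 + |r|) := by
  classical
  have hex : ∃ j : ℕ, r ≤ 4 ^ j := (pow_unbounded_of_one_lt r (by norm_num : (1 : ℝ) < 4)).imp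
    fun _ h => h.le
  refine ⟨Nat.find hex, Nat.find_spec hex, ?_⟩
  have hr : 0 ≤ |r| := abs_nonneg r
  rcases hj : Nat.find hex with _ | i
  · simp; linarith
  · have := Nat.find_min hex (m := i) (by omega)
    rw [pow_succ]
    have h2 := le_abs_self r
    linarith

lemma HasGrowth.summable {F : ℂ → ℂ} {C : ℝ} (hC : HasGrowth F C)
    (hF : Differentiable ℂ F) (h0 : F 0 ≠ 0) :
    Summable fun ρ : ℂ => (analyticOrderNatAt F ρ : ℝ) / (1 + ‖ρ‖) ^ 2 := by
  obtain ⟨K, hK, hfac⟩ := hC.exists_factor hF h0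
  choose J hJ1 hJ2 using fun ρ : ℂ => exists_nat_shell ‖ρ‖
  refine summable_of_sum_le (c := 32 * K) (fun ρ => by positivity) fun u => ?_
  have hterm : ∀ ρ ∈ u, (analyticOrderNatAt F ρ : ℝ) / (1 + ‖ρ‖) ^ 2 ≤
      16 * (1 / 16) ^ J ρ * analyticOrderNatAt F ρ := fun ρ _ => by
    have h1 : (4 : ℝ) ^ J ρ ≤ 4 * (1 + ‖ρ‖) := by simpa using hJ2 ρ
    have h2 : (16 : ℝ) ^ J ρ ≤ 16 * (1 + ‖ρ‖) ^ 2 := by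
      calc (16 : ℝ) ^ J ρ = (4 ^ J ρ) ^ 2 := by rw [← pow_mul, mul_comm, pow_mul]; norm_num
        _ ≤ (4 * (1 + ‖ρ‖)) ^ 2 := by gcongr
        _ = _ := by ring
    rw [div_le_iff₀ (by positivity), one_div, inv_pow]
    have h3 : (0 : ℝ) < 16 ^ J ρ := by positivity
    have h4 : 1 ≤ 16 * (1 + ‖ρ‖) ^ 2 * ((16 : ℝ) ^ J ρ)⁻¹ := by
      rw [← div_eq_mul_inv, le_div_iff₀ h3]; linarith
    have h5 : (0 : ℝ) ≤ analyticOrderNatAt F ρ := by positivity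
    nlinarith
  refine (Finset.sum_le_sum hterm).trans ?_
  rw [← Finset.sum_fiberwise_of_maps_to (t := u.image J) (g := J)
    fun ρ hρ => Finset.mem_image_of_mem J hρ]
  have hfib : ∀ j ∈ u.image J, ∑ ρ ∈ u with J ρ = j, 16 * (1 / 16) ^ J ρ *
      (analyticOrderNatAt F ρ : ℝ) ≤ 16 * K * (1 / 2) ^ j := fun j _ => by
    have : ∑ ρ ∈ u with J ρ = j, (analyticOrderNatAt F ρ : ℝ) ≤ K * 8 ^ j := by
      refine le_trans ?_ (hfac j).1
      norm_cast
      refine Finset.sum_le_sum_of_ne_zero fun ρ hρ hne => ?_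
      rw [Finset.mem_filter] at hρ
      rw [mem_zerosIn hF h0]
      exact ⟨by rw [← hρ.2]; exact_mod_cast hJ1 ρ,
        apply_eq_zero_of_analyticOrderNatAt_ne_zero hne⟩
    calc ∑ ρ ∈ u with J ρ = j, 16 * (1 / 16) ^ J ρ * (analyticOrderNatAt F ρ : ℝ)
        = 16 * (1 / 16) ^ j * ∑ ρ ∈ u with J ρ = j, (analyticOrderNatAt F ρ : ℝ) := by
          rw [Finset.mul_sum]
          refine Finset.sum_congr rfl fun ρ hρ => ?_
          rw [(Finset.mem_filter.1 hρ).2]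
      _ ≤ 16 * (1 / 16) ^ j * (K * 8 ^ j) := by gcongr
      _ = 16 * K * (1 / 2) ^ j := by
          rw [show (1 / 2 : ℝ) = 1 / 16 * 8 by norm_num, mul_pow]; ring
  refine (Finset.sum_le_sum hfib).trans ?_
  rw [← Finset.mul_sum]
  have : ∑ j ∈ u.image J, (1 / 2 : ℝ) ^ j ≤ 2 :=
    (summable_geometric_two.sum_le_tsum _ fun _ _ => by positivity).trans_eq tsum_geometric_two
  nlinarith

lemma HasGrowth.summable_div_pow {F : ℂ → ℂ} {C : ℝ} (hC : HasGrowth F C)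
    (hF : Differentiable ℂ F) (h0 : F 0 ≠ 0) (k : ℕ) (s : ℂ) :
    Summable fun ρ : ℂ => (analyticOrderNatAt F ρ : ℂ) / (s - ρ) ^ (k + 2) := by
  refine Summable.of_norm_bounded_eventually ((hC.summable hF h0).mul_left 4) ?_
  have hfin := finite_zeros_closedBall hF h0 (2 * ‖s‖ + 1)
  filter_upwards [hfin.compl_mem_cofinite] with ρ hρ
  by_cases hm : analyticOrderNatAt F ρ = 0
  · simp [hm]
  have hFρ := apply_eq_zero_of_analyticOrderNatAt_ne_zero hm
  have hlt : 2 * ‖s‖ + 1 < ‖ρ‖ := by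
    by_contra! hle
    exact hρ ⟨by simpa using hle, hFρ⟩
  have hn := norm_sub_norm_le ρ s
  rw [norm_sub_rev] at hn
  have hs := norm_nonneg s
  have h1 : (1 + ‖ρ‖) / 2 ≤ ‖s - ρ‖ := by linarith
  have h2 : 1 ≤ ‖s - ρ‖ := by linarith
  rw [norm_div, norm_pow, norm_natCast]
  calc (analyticOrderNatAt F ρ : ℝ) / ‖s - ρ‖ ^ (k + 2)
      ≤ analyticOrderNatAt F ρ / ((1 + ‖ρ‖) / 2) ^ 2 := by
        gcongr
        calc ((1 + ‖ρ‖) / 2) ^ 2 ≤ ‖s - ρ‖ ^ 2 := by gcongr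
          _ ≤ ‖s - ρ‖ ^ (k + 2) := pow_le_pow_right₀ h2 (by omega)
    _ = 4 * (analyticOrderNatAt F ρ / (1 + ‖ρ‖) ^ 2) := by field_simp; norm_num

lemma iteratedDeriv_inv_sub (n : ℕ) (ρ s : ℂ) :
    iteratedDeriv n (fun z => (z - ρ)⁻¹) s = (-1) ^ n * n.factorial / (s - ρ) ^ (n + 1) := by
  rw [iteratedDeriv_comp_sub_const n Inv.inv ρ, iteratedDeriv_eq_iterate]
  simp only [iter_deriv_inv']
  rw [show (-1 - n : ℤ) = -((n + 1 : ℕ) : ℤ) by push_cast; ring, zpow_neg, zpow_natCast,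
    div_eq_mul_inv]

lemma iteratedDeriv_logDeriv_factor {F g : ℂ → ℂ} {S : Finset ℂ} {m : ℂ → ℕ}
    (hF : Differentiable ℂ F) (hg : Differentiable ℂ g) (hS : ∀ ρ ∈ S, ρ ≠ 0 ∧ F ρ = 0)
    (hFg : ∀ z, F z = (∏ ρ ∈ S, (1 - z / ρ) ^ m ρ) * g z) {s : ℂ} (hs : F s ≠ 0) (n : ℕ) :
    iteratedDeriv n (logDeriv F) s =
      (-1) ^ n * n.factorial * ∑ ρ ∈ S, (m ρ : ℂ) / (s - ρ) ^ (n + 1) +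
        iteratedDeriv n (logDeriv g) s := by
  have hsS : ∀ ρ ∈ S, s - ρ ≠ 0 := fun ρ hρ h => hs (sub_eq_zero.1 h ▸ (hS ρ hρ).2)
  have hgs : g s ≠ 0 := fun h => hs (by rw [hFg, h, mul_zero])
  have hev : logDeriv F =ᶠ[𝓝 s]
      (fun z => ∑ ρ ∈ S, (m ρ : ℂ) * (z - ρ)⁻¹) + logDeriv g := by
    filter_upwards [hF.continuous.continuousAt.eventually_ne hs] with z hz
    have hgz : g z ≠ 0 := fun h => hz (by rw [hFg, h, mul_zero])
    have hP : ∏ ρ ∈ S, (1 - z / ρ) ^ m ρ ≠ 0 := fun h => hz (by rw [hFg, h, zero_mul])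
    rw [show F = fun z => (∏ ρ ∈ S, (1 - z / ρ) ^ m ρ) * g z from funext hFg,
      logDeriv_mul z hP hgz (by fun_prop) (hg z), Pi.add_apply]
    congr 1
    rw [logDeriv_prod (f := fun ρ z => (1 - z / ρ) ^ m ρ) (Finset.prod_ne_zero_iff.1 hP)
      (fun ρ _ => by fun_prop)]
    refine Finset.sum_congr rfl fun ρ hρ => ?_
    have hρ0 := (hS ρ hρ).1
    have hzρ : z - ρ ≠ 0 := fun h => hz (sub_eq_zero.1 h ▸ (hS ρ hρ).2)
    rw [logDeriv_fun_pow (f := fun z => 1 - z / ρ) (by fun_prop), logDeriv_apply]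
    have : ρ - z ≠ 0 := by rw [← neg_sub]; exact neg_ne_zero.2 hzρ
    simp only [deriv_const_sub, deriv_div_const, deriv_id'']
    congr 1
    rw [show (1 : ℂ) - z / ρ = -(z - ρ) / ρ by field_simp; ring]
    field_simp
  have hsm : ∀ ρ ∈ S, ContDiffAt ℂ n (fun z => (m ρ : ℂ) * (z - ρ)⁻¹) s := fun ρ hρ =>
    contDiffAt_const.mul ((contDiffAt_id.sub contDiffAt_const).inv (hsS ρ hρ))
  have hgsm : ContDiffAt ℂ n (logDeriv g) s :=
    ((hg.analyticAt s).deriv.div (hg.analyticAt s) hgs).contDiffAt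
  rw [hev.iteratedDeriv_eq, iteratedDeriv_add (ContDiffAt.sum hsm) hgsm,
    iteratedDeriv_fun_sum hsm, Finset.mul_sum]
  congr 1
  refine Finset.sum_congr rfl fun ρ _ => ?_
  rw [iteratedDeriv_const_mul_field, iteratedDeriv_inv_sub]
  ring

theorem HasGrowth.iteratedDeriv_logDeriv {F : ℂ → ℂ} {C : ℝ} (hC : HasGrowth F C)
    (hF : Differentiable ℂ F) (h0 : F 0 ≠ 0) (k : ℕ) {s : ℂ} (hs : F s ≠ 0) :
    iteratedDeriv (k + 1) (logDeriv F) s = (-1) ^ (k + 1) * (k + 1).factorial *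
      ∑' ρ : ℂ, (analyticOrderNatAt F ρ : ℂ) / (s - ρ) ^ (k + 2) := by
  obtain ⟨K, hK, hfac⟩ := hC.exists_factor hF h0
  choose g hg hg0 hgne hFg hgM using fun j => (hfac j).2
  have hsum := hC.summable_div_pow hF h0 k s
  set t : ℂ → ℂ := fun ρ => (analyticOrderNatAt F ρ : ℂ) / (s - ρ) ^ (k + 2) with ht
  have h4 : Tendsto (fun j : ℕ => (4 : ℝ) ^ j) atTop atTop :=
    tendsto_pow_atTop_atTop_of_one_lt (by norm_num)
  have hlim1 : Tendsto (fun j : ℕ => ∑ ρ ∈ zerosIn F (4 ^ j), t ρ) atTop (𝓝 (∑' ρ, t ρ)) := by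
    classical
    have := tendsto_tsum_of_dominated_convergence (𝓕 := atTop) (bound := fun ρ => ‖t ρ‖)
      (f := fun (j : ℕ) ρ => if ρ ∈ zerosIn F (4 ^ j) then t ρ else 0) (g := t) hsum.norm
      (fun ρ => ?_) (Eventually.of_forall fun j ρ => ?_)
    · refine this.congr fun j => ?_
      rw [tsum_eq_sum (s := zerosIn F (4 ^ j)) (fun ρ hρ => if_neg hρ)]
      exact Finset.sum_congr rfl fun ρ hρ => if_pos hρ
    · refine tendsto_const_nhds.congr' ?_
      filter_upwards [h4.eventually_ge_atTop ‖ρ‖] with j hj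
      by_cases hm : analyticOrderNatAt F ρ = 0
      · simp [t, hm]
      · rw [if_pos]
        exact (mem_zerosIn hF h0).2 ⟨hj, apply_eq_zero_of_analyticOrderNatAt_ne_zero hm⟩
    · split_ifs <;> simp
  have hlim2 : Tendsto (fun j : ℕ => iteratedDeriv (k + 1) (logDeriv (g j)) s) atTop (𝓝 0) := by
    refine squeeze_zero_norm' (a := fun j : ℕ =>
      ((k + 2).factorial * (2 * K) * 4 ^ (k + 2)) * (1 / 2 : ℝ) ^ j) ?_ ?_
    · filter_upwards [h4.eventually_ge_atTop (4 * ‖s‖)] with j hj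
      have hj1 : (1 : ℝ) ≤ 4 ^ j := one_le_pow₀ (by norm_num)
      refine (norm_iteratedDeriv_logDeriv_le (by positivity) (by positivity) (hg j) (hgne j) (hgM j)
        (by linarith) (k + 1)).trans ?_
      rw [div_pow, ← div_mul, div_mul_eq_mul_div, div_le_iff₀ (by positivity)]
      have hpow : (8 : ℝ) ^ j ≤ (1 / 2) ^ j * (4 ^ j) ^ (k + 2) := by
        calc (8 : ℝ) ^ j = (1 / 2) ^ j * (4 ^ j) ^ 2 := by
              rw [← pow_mul, mul_comm j 2, pow_mul, ← mul_pow]; norm_num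
          _ ≤ _ := mul_le_mul_of_nonneg_left (pow_le_pow_right₀ hj1 (by omega)) (by positivity)
      have : (0 : ℝ) ≤ (k + 2).factorial * (2 * K) * 4 ^ (k + 2) := by positivity
      nlinarith [mul_le_mul_of_nonneg_left hpow this]
    · rw [← mul_zero ((k + 2).factorial * (2 * K) * 4 ^ (k + 2) : ℝ)]
      exact (tendsto_pow_atTop_nhds_zero_of_lt_one (by norm_num) (by norm_num)).const_mul _
  have hlim := (hlim1.const_mul ((-1 : ℂ) ^ (k + 1) * (k + 1).factorial)).add hlim2
  rw [add_zero] at hlim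
  refine tendsto_nhds_unique (tendsto_const_nhds.congr fun j => ?_) hlim
  refine iteratedDeriv_logDeriv_factor hF (hg j) (fun ρ hρ => ?_) (hFg j) hs (k + 1)
  have := ((mem_zerosIn hF h0).1 hρ).2
  exact ⟨fun h => h0 (h ▸ this), this⟩

/-- The restriction of `f` to `S` has growth order at most `3 / 2`. -/
def GrowthOn (S : Set ℂ) (f : ℂ → ℂ) : Prop :=
  ∃ C : ℝ, 0 ≤ C ∧ ∀ (j : ℕ) (z : ℂ), z ∈ S → ‖z‖ ≤ 4 ^ j → ‖f z‖ ≤ Real.exp (C * 8 ^ j)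

lemma GrowthOn.mul {S : Set ℂ} {f g : ℂ → ℂ} (hf : GrowthOn S f) (hg : GrowthOn S g) :
    GrowthOn S fun z => f z * g z := by
  obtain ⟨A, hA, hf⟩ := hf
  obtain ⟨B, hB, hg⟩ := hg
  refine ⟨A + B, by positivity, fun j z hz hj => ?_⟩
  rw [norm_mul, add_mul, Real.exp_add]
  exact mul_le_mul (hf j z hz hj) (hg j z hz hj) (norm_nonneg _) (Real.exp_pos _).le

lemma GrowthOn.add {S : Set ℂ} {f g : ℂ → ℂ} (hf : GrowthOn S f) (hg : GrowthOn S g) :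
    GrowthOn S fun z => f z + g z := by
  obtain ⟨A, hA, hf⟩ := hf
  obtain ⟨B, hB, hg⟩ := hg
  refine ⟨A + B + 1, by positivity, fun j z hz hj => ?_⟩
  have h8 : (1 : ℝ) ≤ 8 ^ j := one_le_pow₀ (by norm_num)
  have h2 : 2 ≤ Real.exp (8 ^ j) := by linarith [Real.add_one_le_exp ((8 : ℝ) ^ j)]
  have h3 : Real.exp (A * 8 ^ j) ≤ Real.exp ((A + B) * 8 ^ j) := by gcongr; linarith
  have h4 : Real.exp (B * 8 ^ j) ≤ Real.exp ((A + B) * 8 ^ j) := by gcongr; linarith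
  rw [add_mul _ 1, one_mul, Real.exp_add]
  refine (norm_add_le _ _).trans ?_
  nlinarith [hf j z hz hj, hg j z hz hj, Real.exp_pos ((A + B) * 8 ^ j)]

lemma GrowthOn.congr {S : Set ℂ} {f g : ℂ → ℂ} (hf : GrowthOn S f) (h : ∀ z ∈ S, f z = g z) :
    GrowthOn S g := by
  obtain ⟨A, hA, hf⟩ := hf
  exact ⟨A, hA, fun j z hz hj => h z hz ▸ hf j z hz hj⟩

lemma GrowthOn.union {S T : Set ℂ} {f : ℂ → ℂ} (hS : GrowthOn S f) (hT : GrowthOn T f) :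
    GrowthOn (S ∪ T) f := by
  obtain ⟨A, hA, hS⟩ := hS
  obtain ⟨B, hB, hT⟩ := hT
  refine ⟨A + B, by positivity, fun j z hz hj => ?_⟩
  rcases hz with hz | hz
  · exact (hS j z hz hj).trans (by gcongr; linarith)
  · exact (hT j z hz hj).trans (by gcongr; linarith)

lemma GrowthOn.of_le_exp {S : Set ℂ} {f : ℂ → ℂ} (a : ℝ) (ha : 0 ≤ a)
    (h : ∀ z ∈ S, ‖f z‖ ≤ Real.exp (a * (1 + ‖z‖))) : GrowthOn S f := by
  refine ⟨2 * a, by positivity, fun j z hz hj => (h z hz).trans ?_⟩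
  have h8 : (1 : ℝ) ≤ 8 ^ j := one_le_pow₀ (by norm_num)
  have h4 : (4 : ℝ) ^ j ≤ 8 ^ j := by gcongr; norm_num
  rw [mul_comm 2 a, mul_assoc]
  gcongr
  linarith

lemma GrowthOn.of_norm_le {S : Set ℂ} {f : ℂ → ℂ} (M : ℝ) (h : ∀ z ∈ S, ‖f z‖ ≤ M) :
    GrowthOn S f := by
  refine .of_le_exp |M| (abs_nonneg M) fun z hz => (h z hz).trans ((le_abs_self M).trans ?_)
  have := Real.add_one_le_exp (|M| * (1 + ‖z‖))
  nlinarith [mul_nonneg (abs_nonneg M) (norm_nonneg z)]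

lemma growthOn_const {S : Set ℂ} (c : ℂ) : GrowthOn S fun _ => c :=
  .of_norm_le ‖c‖ fun _ _ => le_rfl

lemma growthOn_id {S : Set ℂ} : GrowthOn S fun z => z := by
  refine .of_le_exp 1 zero_le_one fun z _ => ?_
  linarith [Real.add_one_le_exp (1 * (1 + ‖z‖))]

lemma growthOn_exp_linear {S : Set ℂ} (a b : ℂ) : GrowthOn S fun z => exp (a * z + b) := by
  refine .of_le_exp (‖a‖ + ‖b‖) (by positivity) fun z _ => (norm_exp_le_exp_norm _).trans ?_
  gcongr
  refine (norm_add_le _ _).trans ?_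
  rw [norm_mul]
  nlinarith [norm_nonneg a, norm_nonneg b, norm_nonneg z, mul_nonneg (norm_nonneg b) (norm_nonneg z)]

lemma growthOn_sin_linear {S : Set ℂ} (a b : ℂ) : GrowthOn S fun z => sin (a * z + b) := by
  refine ((((growthOn_exp_linear (-a * I) (-b * I)).add ((growthOn_const (-1)).mul
    (growthOn_exp_linear (a * I) (b * I)))).mul (growthOn_const (I / 2)))).congr fun z _ => ?_
  rw [Complex.sin]
  ring_nf

lemma growthOn_cos_linear {S : Set ℂ} (a b : ℂ) : GrowthOn S fun z => cos (a * z + b) := by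
  refine (growthOn_sin_linear (S := S) a (b + Real.pi / 2)).congr fun z _ => ?_
  rw [← add_assoc, Complex.sin_add_pi_div_two]

lemma GrowthOn.hasGrowth {f : ℂ → ℂ} (h : GrowthOn Set.univ f) : ∃ C, HasGrowth f C := by
  obtain ⟨C, -, h⟩ := h
  exact ⟨C, fun j z hz => h j z trivial hz⟩

open MeasureTheory in
lemma exists_norm_mellin_le_of_re_mem_Icc {f : ℝ → ℂ} {a b : ℝ} (ha : MellinConvergent f a)
    (hb : MellinConvergent f b) : ∃ M, ∀ s : ℂ, s.re ∈ Set.Icc a b → ‖mellin f s‖ ≤ M := by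
  refine ⟨(∫ t : ℝ in Set.Ioi 0, ‖(t : ℂ) ^ ((a : ℂ) - 1) • f t‖) +
    ∫ t : ℝ in Set.Ioi 0, ‖(t : ℂ) ^ ((b : ℂ) - 1) • f t‖, fun s hs => ?_⟩
  rw [← integral_add ha.norm hb.norm]
  refine norm_integral_le_of_norm_le (ha.norm.add hb.norm) ?_
  filter_upwards [ae_restrict_mem measurableSet_Ioi] with t ht
  have ht : 0 < t := ht
  simp only [norm_smul, norm_cpow_eq_rpow_re_of_pos ht, ← add_mul]
  gcongr
  simp only [sub_re, ofReal_re, one_re]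
  rcases le_total 1 t with h1 | h1
  · have := Real.rpow_le_rpow_of_exponent_le h1 (show s.re - 1 ≤ b - 1 by linarith [hs.2])
    have := Real.rpow_nonneg ht.le (a - 1)
    linarith
  · have := Real.rpow_le_rpow_of_exponent_ge ht h1 (show a - 1 ≤ s.re - 1 by linarith [hs.1])
    have := Real.rpow_nonneg ht.le (b - 1)
    linarith

lemma mellinConvergent_exp_neg {s : ℂ} (hs : 0 < s.re) :
    MellinConvergent (fun x : ℝ => ((Real.exp (-x) : ℝ) : ℂ)) s := by
  refine (GammaIntegral_convergent hs).congr_fun (fun x _ => ?_) measurableSet_Ioi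
  simp only [smul_eq_mul, mul_comm]

lemma exists_norm_Gamma_le_of_re_mem_Icc {a b : ℝ} (ha : 0 < a) :
    ∃ M, ∀ s : ℂ, s.re ∈ Set.Icc a b → ‖Gamma s‖ ≤ M := by
  by_cases hab : a ≤ b
  · obtain ⟨M, hM⟩ := exists_norm_mellin_le_of_re_mem_Icc
      (mellinConvergent_exp_neg (s := a) (by simpa))
      (mellinConvergent_exp_neg (s := b) (by simpa using ha.trans_le hab))
    refine ⟨M, fun s hs => ?_⟩
    rw [Gamma_eq_integral (ha.trans_le hs.1), GammaIntegral_eq_mellin]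
    exact hM s hs
  · exact ⟨0, fun s hs => absurd (hs.1.trans hs.2) hab⟩

lemma norm_Gamma_le_Gamma_re {s : ℂ} (hs : 0 < s.re) : ‖Gamma s‖ ≤ Real.Gamma s.re := by
  rw [Gamma_eq_integral hs, Real.Gamma_eq_integral hs, GammaIntegral]
  refine (MeasureTheory.norm_integral_le_integral_norm _).trans_eq
    (MeasureTheory.setIntegral_congr_fun measurableSet_Ioi fun x hx => ?_)
  simp only [norm_mul, norm_cpow_eq_rpow_re_of_pos hx, norm_real, Real.norm_eq_abs, Real.abs_exp,
    sub_re, one_re]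

lemma exists_norm_completedRiemannZeta₀_le_of_re_mem_Icc (a b : ℝ) :
    ∃ M, ∀ s : ℂ, s.re ∈ Set.Icc a b → ‖completedRiemannZeta₀ s‖ ≤ M := by
  have hconv : ∀ s, MellinConvergent (HurwitzZeta.hurwitzEvenFEPair 0).f_modif s := fun s =>
    ((HurwitzZeta.hurwitzEvenFEPair 0).isStrongFEPair_toStrongFEPair.hasMellin s).1
  obtain ⟨M, hM⟩ := exists_norm_mellin_le_of_re_mem_Icc (hconv ((a / 2 : ℝ) : ℂ))
    (hconv ((b / 2 : ℝ) : ℂ))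
  refine ⟨M / 2, fun s hs => ?_⟩
  have : s.re / 2 ∈ Set.Icc (a / 2) (b / 2) := ⟨by linarith [hs.1], by linarith [hs.2]⟩
  rw [completedRiemannZeta₀, HurwitzZeta.completedHurwitzZetaEven₀, WeakFEPair.Λ₀, norm_div,
    norm_ofNat]
  gcongr
  exact hM _ (by simpa using this)

lemma exists_norm_riemannZeta_le_of_le_re {a : ℝ} (ha : 1 < a) :
    ∃ M, ∀ s : ℂ, a ≤ s.re → ‖riemannZeta s‖ ≤ M := by
  refine ⟨∑' n : ℕ, 1 / ((n + 1 : ℕ) : ℝ) ^ a, fun s hs => ?_⟩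
  rw [zeta_eq_tsum_one_div_nat_add_one_cpow (ha.trans_le hs)]
  refine tsum_of_norm_bounded (((summable_nat_add_iff 1).2
    (Real.summable_one_div_nat_rpow.2 ha)).hasSum) fun n => ?_
  have h0 : (0 : ℝ) < (n + 1 : ℕ) := by positivity
  have h1 : (1 : ℝ) ≤ (n + 1 : ℕ) := by simp
  rw [norm_div, norm_one, show (n + 1 : ℂ) = (((n + 1 : ℕ) : ℝ) : ℂ) by push_cast; rfl,
    norm_cpow_eq_rpow_re_of_pos h0]
  gcongr

lemma growthOn_Gamma_one_sub : GrowthOn {z | z.re ≤ -1 / 2} fun z => Gamma (1 - z) := by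
  refine ⟨8, by norm_num, fun j z hz hj => ?_⟩
  have hz : z.re ≤ -1 / 2 := hz
  set x := 1 - z.re with hx
  have hx1 : 3 / 2 ≤ x := by linarith
  have hx2 : x ≤ 4 ^ j + 1 := by
    have := (abs_le.1 ((abs_re_le_norm z).trans hj)).1
    linarith
  have h1 : ‖Gamma (1 - z)‖ ≤ Real.Gamma x := by
    have := norm_Gamma_le_Gamma_re (s := 1 - z) (by simp; linarith)
    simpa using this
  have h2 : Real.Gamma x ≤ Real.Gamma (x + 1) := by
    rw [Real.Gamma_add_one (by linarith)]
    exact le_mul_of_one_le_left (Real.Gamma_pos_of_pos (by linarith)).le (by linarith)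
  have h3 : Real.Gamma (x + 1) ≤ ((4 ^ j + 1).factorial : ℕ) := by
    rw [← Real.Gamma_nat_eq_factorial]
    refine Real.Gamma_strictMonoOn_Ici.monotoneOn ?_ ?_ ?_
    · simp; linarith
    · have : (1 : ℝ) ≤ 4 ^ j := one_le_pow₀ (by norm_num)
      simp; linarith
    · push_cast; linarith
  have h4 : (4 ^ j + 1).factorial ≤ 4 ^ ((j + 1) * (2 * 4 ^ j)) := by
    have h41 : 1 ≤ 4 ^ j := Nat.one_le_pow _ _ (by norm_num)
    calc (4 ^ j + 1).factorial ≤ (4 ^ j + 1) ^ (4 ^ j + 1) := Nat.factorial_le_pow _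
      _ ≤ (4 ^ (j + 1)) ^ (4 ^ j + 1) := by gcongr; rw [pow_succ]; omega
      _ ≤ (4 ^ (j + 1)) ^ (2 * 4 ^ j) := by gcongr <;> omega
      _ = _ := by rw [← pow_mul]
  have h5 : (j + 1) * (2 * 4 ^ j) ≤ 2 * 8 ^ j := by
    have : j + 1 ≤ 2 ^ j := Nat.lt_two_pow_self
    calc (j + 1) * (2 * 4 ^ j) ≤ 2 ^ j * (2 * 4 ^ j) := by gcongr
      _ = 2 * (2 * 4) ^ j := by rw [mul_pow]; ring
  have h6 : ((4 : ℝ)) ≤ Real.exp 1 ^ 4 := by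
    have := Real.exp_one_gt_d9
    calc (4 : ℝ) ≤ 2 ^ 4 := by norm_num
      _ ≤ _ := by gcongr; linarith
  calc ‖Gamma (1 - z)‖ ≤ ((4 ^ ((j + 1) * (2 * 4 ^ j)) : ℕ) : ℝ) :=
        h1.trans (h2.trans (h3.trans (by exact_mod_cast h4)))
    _ ≤ (4 : ℝ) ^ (2 * 8 ^ j) := by push_cast; gcongr; norm_num
    _ ≤ (Real.exp 1 ^ 4) ^ (2 * 8 ^ j) := by gcongr
    _ = _ := by rw [← pow_mul, Real.exp_one_pow]; push_cast; ring_nf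

/-- The entire function `(z - 1) ζ(z)`. -/
noncomputable def subOneMulZeta (z : ℂ) : ℂ :=
  (z * (z - 1) * completedRiemannZeta₀ z + 1) * (exp (Real.log Real.pi / 2 * z) *
    ((Gamma (z / 2 + 1))⁻¹ * (1 / 2)))

lemma differentiable_subOneMulZeta : Differentiable ℂ subOneMulZeta := by
  have h1 := differentiable_completedZeta₀
  have h2 : Differentiable ℂ fun z : ℂ => (Gamma (z / 2 + 1))⁻¹ :=
    differentiable_one_div_Gamma.comp (by fun_prop : Differentiable ℂ fun z : ℂ => z / 2 + 1)
  unfold subOneMulZeta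
  fun_prop

lemma subOneMulZeta_eq {z : ℂ} (hz : z ≠ 1) : subOneMulZeta z = (z - 1) * riemannZeta z := by
  have h1 : 1 - z ≠ 0 := sub_ne_zero.2 hz.symm
  have h1' : z - 1 ≠ 0 := sub_ne_zero.2 hz
  have hpi : (Real.pi : ℂ) ≠ 0 := ofReal_ne_zero.2 Real.pi_ne_zero
  have he : (Real.pi : ℂ) ^ (-z / 2) = (exp (Real.log Real.pi / 2 * z))⁻¹ := by
    rw [cpow_def_of_ne_zero hpi, ← Complex.exp_neg, ofReal_log Real.pi_pos.le]
    ring_nf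
  rw [riemannZeta_eq_mul_completedRiemannZeta₀, he, subOneMulZeta]
  have hA : z * completedRiemannZeta₀ z - 1 - z / (1 - z) =
      (z * (z - 1) * completedRiemannZeta₀ z + 1) / (z - 1) := by
    field_simp
    ring
  rw [hA, div_div, ← mul_div_assoc (z - 1), mul_div_mul_left _ _ h1']
  simp only [div_eq_mul_inv, mul_inv, inv_inv]
  ring

lemma subOneMulZeta_zero_ne_zero : subOneMulZeta 0 ≠ 0 := by
  rw [subOneMulZeta_eq zero_ne_one, riemannZeta_zero]
  norm_num

lemma subOneMulZeta_one_ne_zero : subOneMulZeta 1 ≠ 0 := by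
  have : Gamma (1 / 2 + 1) ≠ 0 := Gamma_ne_zero_of_re_pos (by norm_num)
  simp only [subOneMulZeta, sub_self, mul_zero, zero_mul, zero_add, one_mul]
  exact mul_ne_zero (Complex.exp_ne_zero _) (mul_ne_zero (inv_ne_zero this) (by norm_num))

lemma growthOn_subOneMulZeta_right : GrowthOn {z | 3 / 2 ≤ z.re} subOneMulZeta := by
  obtain ⟨M, hM⟩ := exists_norm_riemannZeta_le_of_le_re (a := 3 / 2) (by norm_num)
  refine ((growthOn_id.add (growthOn_const (-1))).mul (.of_norm_le M hM)).congr fun z hz => ?_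
  have hz : 3 / 2 ≤ z.re := hz
  rw [subOneMulZeta_eq (by rintro rfl; norm_num at hz), sub_eq_add_neg]

lemma growthOn_subOneMulZeta_left : GrowthOn {z | z.re ≤ -1 / 2} subOneMulZeta := by
  obtain ⟨M, hM⟩ := exists_norm_riemannZeta_le_of_le_re (a := 3 / 2) (by norm_num)
  have h1 : GrowthOn {z | z.re ≤ -1 / 2} fun z => riemannZeta (1 - z) :=
    .of_norm_le M fun z hz => hM _ (by
      have hz : z.re ≤ -1 / 2 := hz
      simp; linarith)
  refine ((growthOn_id.add (growthOn_const (-1))).mul ((((growthOn_const 2).mul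
    (growthOn_exp_linear (log (2 * Real.pi)) (-log (2 * Real.pi)))).mul
    growthOn_Gamma_one_sub).mul (growthOn_cos_linear (-(Real.pi / 2)) (Real.pi / 2)) |>.mul
    h1)).congr fun z hz => ?_
  have hz : z.re ≤ -1 / 2 := hz
  have h2 : (1 - z).re = 1 - z.re := by simp
  rw [subOneMulZeta_eq (by rintro rfl; norm_num at hz)]
  conv_rhs => rw [← sub_sub_cancel 1 z]
  rw [riemannZeta_one_sub (s := 1 - z), cpow_def_of_ne_zero]
  · ring_nf
  · simp [Real.pi_ne_zero]
  · intro n h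
    rw [h] at h2
    have : (0 : ℝ) ≤ n := n.cast_nonneg
    simp at h2
    linarith
  · intro h
    rw [h] at h2
    simp at h2
    linarith

lemma growthOn_inv_Gamma_strip :
    GrowthOn {z | z.re ∈ Set.Icc (-1 / 2) (3 / 2) ∧ 1 ≤ ‖z‖} fun z => (Gamma (z / 2 + 1))⁻¹ := by
  obtain ⟨M, hM⟩ := exists_norm_Gamma_le_of_re_mem_Icc (a := 1 / 4) (b := 5 / 4) (by norm_num)
  have hmem : ∀ z : ℂ, z.re ∈ Set.Icc (-1 / 2 : ℝ) (3 / 2) →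
      (1 - z / 2).re ∈ Set.Icc (1 / 4 : ℝ) (5 / 4) := fun z hz => by
    have := hz.1
    have := hz.2
    constructor <;> simp <;> linarith
  have h1 : GrowthOn {z | z.re ∈ Set.Icc (-1 / 2) (3 / 2) ∧ 1 ≤ ‖z‖} fun z => Gamma (1 - z / 2) :=
    .of_norm_le M fun z hz => hM _ (hmem z hz.1)
  have h2 : GrowthOn {z | z.re ∈ Set.Icc (-1 / 2) (3 / 2) ∧ 1 ≤ ‖z‖} fun z => z⁻¹ :=
    .of_norm_le 1 fun z hz => by
      rw [norm_inv]
      exact inv_le_one_of_one_le₀ hz.2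
  refine ((growthOn_const (2 / Real.pi)).mul (h2.mul (h1.mul
    (growthOn_sin_linear (Real.pi / 2) 0)))).congr fun z hz => ?_
  have hz0 : z ≠ 0 := norm_pos_iff.1 (zero_lt_one.trans_le hz.2)
  have hG : Gamma (1 - z / 2) ≠ 0 :=
    Gamma_ne_zero_of_re_pos (lt_of_lt_of_le (by norm_num) (hmem z hz.1).1)
  have href := congrArg (·⁻¹) (Gamma_mul_Gamma_one_sub (z / 2))
  simp only [mul_inv, inv_div] at href
  rw [Gamma_add_one _ (by simpa using hz0), mul_inv, ← mul_inv_cancel_right₀ hG (Gamma (z / 2))⁻¹,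
    mul_right_comm _ _ (Gamma (1 - z / 2))⁻¹, href]
  have hpi : (Real.pi : ℂ) ≠ 0 := ofReal_ne_zero.2 Real.pi_ne_zero
  rw [add_zero, show (Real.pi : ℂ) / 2 * z = Real.pi * (z / 2) by ring]
  field_simp

lemma growthOn_subOneMulZeta_strip :
    GrowthOn {z | z.re ∈ Set.Icc (-1 / 2) (3 / 2) ∧ 1 ≤ ‖z‖} subOneMulZeta := by
  obtain ⟨M, hM⟩ := exists_norm_completedRiemannZeta₀_le_of_re_mem_Icc (-1 / 2) (3 / 2)
  have hexp (S : Set ℂ) : GrowthOn S fun z => exp (Real.log Real.pi / 2 * z) := by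
    simpa using growthOn_exp_linear (S := S) (Real.log Real.pi / 2) 0
  exact (((growthOn_id.mul (growthOn_id.add (growthOn_const (-1)))).mul
    (.of_norm_le M fun z hz => hM z hz.1)).add (growthOn_const 1)).mul
    ((hexp _).mul (growthOn_inv_Gamma_strip.mul (growthOn_const (1 / 2))))

lemma exists_hasGrowth_subOneMulZeta : ∃ C, HasGrowth subOneMulZeta C := by
  obtain ⟨M, hM⟩ := (isCompact_closedBall (0 : ℂ) 1).exists_bound_of_continuousOn
    differentiable_subOneMulZeta.continuous.continuousOn
  have h := ((growthOn_subOneMulZeta_right.union growthOn_subOneMulZeta_left).union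
    growthOn_subOneMulZeta_strip).union (.of_norm_le M hM)
  refine GrowthOn.hasGrowth ?_
  convert h
  refine (Set.eq_univ_of_forall fun z => ?_).symm
  simp only [Set.mem_union, Set.mem_ofPred_eq, Set.mem_Icc, mem_closedBall_zero_iff]
  grind

lemma zeroMult_eq_analyticOrderNatAt {f : ℂ → ℂ} {ρ : ℂ} (hf : AnalyticAt ℂ f ρ)
    (h : analyticOrderAt f ρ ≠ ⊤) : zeroMult f ρ = analyticOrderNatAt f ρ := by
  have : {n : ℕ | ∃ g : ℂ → ℂ, AnalyticAt ℂ g ρ ∧ ∀ᶠ z in 𝓝 ρ, f z = (z - ρ) ^ n * g z} =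
      Set.Iic (analyticOrderNatAt f ρ) := by
    ext n
    rw [Set.mem_Iic, ← ENat.natCast_le_natCast, Nat.cast_analyticOrderNatAt h,
      natCast_le_analyticOrderAt hf]
    rfl
  rw [zeroMult, this, csSup_Iic]

lemma zeroMult_riemannZeta_one : zeroMult riemannZeta 1 = 0 := by
  have : {n : ℕ | ∃ g : ℂ → ℂ, AnalyticAt ℂ g 1 ∧
      ∀ᶠ z in 𝓝 1, riemannZeta z = (z - 1) ^ n * g z} = ∅ := by
    refine Set.eq_empty_of_forall_notMem fun n ⟨g, hg, hev⟩ => ?_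
    have h1 : Tendsto (fun z : ℂ => (z - 1) * ((z - 1) ^ n * g z)) (𝓝 1) (𝓝 0) := by
      have : ContinuousAt (fun z : ℂ => (z - 1) * ((z - 1) ^ n * g z)) 1 := by
        have := hg.continuousAt
        fun_prop
      simpa [ContinuousAt] using this
    refine zero_ne_one (tendsto_nhds_unique ((h1.mono_left nhdsWithin_le_nhds).congr' ?_)
      riemannZeta_residue_one)
    filter_upwards [hev.filter_mono nhdsWithin_le_nhds] with z hz
    rw [hz]
  rw [zeroMult, this, csSup_empty, Nat.bot_eq_zero]

lemma zeroMult_riemannZeta (ρ : ℂ) :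
    zeroMult riemannZeta ρ = analyticOrderNatAt subOneMulZeta ρ := by
  have hF := differentiable_subOneMulZeta
  by_cases hρ : ρ = 1
  · subst hρ
    rw [zeroMult_riemannZeta_one, analyticOrderNatAt,
      (hF.analyticAt 1).analyticOrderAt_eq_zero.2 subOneMulZeta_one_ne_zero]
    rfl
  have hζ : AnalyticAt ℂ riemannZeta ρ := by
    refine DifferentiableOn.analyticAt (s := {1}ᶜ) (fun z hz => ?_)
      (isOpen_ne.mem_nhds hρ)
    exact (differentiableAt_riemannZeta hz).differentiableWithinAt
  have hsub : AnalyticAt ℂ (fun z : ℂ => z - 1) ρ := by fun_prop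
  have hord : analyticOrderAt subOneMulZeta ρ = analyticOrderAt riemannZeta ρ := by
    have hev : subOneMulZeta =ᶠ[𝓝 ρ] (fun z => z - 1) * riemannZeta := by
      filter_upwards [isOpen_ne.mem_nhds hρ] with z hz
      exact subOneMulZeta_eq hz
    rw [analyticOrderAt_congr hev, analyticOrderAt_mul hsub hζ,
      hsub.analyticOrderAt_eq_zero.2 (sub_ne_zero.2 hρ), zero_add]
  have htop := analyticOrderAt_ne_top_of_differentiable hF subOneMulZeta_one_ne_zero ρ
  rw [zeroMult_eq_analyticOrderNatAt hζ (hord ▸ htop), analyticOrderNatAt, analyticOrderNatAt, hord]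

lemma logDeriv_riemannZeta_eq {z : ℂ} (hz : z ≠ 1) (h0 : riemannZeta z ≠ 0) :
    deriv riemannZeta z / riemannZeta z = logDeriv subOneMulZeta z - (z - 1)⁻¹ := by
  have hev : subOneMulZeta =ᶠ[𝓝 z] fun z => (z - 1) * riemannZeta z := by
    filter_upwards [isOpen_ne.mem_nhds hz] with w hw
    exact subOneMulZeta_eq hw
  have h1 : logDeriv subOneMulZeta z = logDeriv (fun z => (z - 1) * riemannZeta z) z := by
    rw [logDeriv_apply, logDeriv_apply, hev.deriv_eq, hev.eq_of_nhds]
  rw [h1, logDeriv_mul (f := fun z => z - 1) z (sub_ne_zero.2 hz) h0 (by fun_prop)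
    (differentiableAt_riemannZeta hz), logDeriv_apply, logDeriv_apply]
  simp

/-- For every `k ≥ 0` and every `s` with `s ≠ 1`, `ζ(s) ≠ 0` and `s` not a trivial zero,
`W^{(k)}(s) = (-1)^k (k+1)! (1/(s-1)^{k+2} - ∑*_ρ 1/(s-ρ)^{k+2})`, the sum running over all
zeros of `ζ` (trivial and nontrivial) counted with multiplicity. -/
theorem iteratedDeriv_zetaLogDerivDeriv (k : ℕ) (s : ℂ) (hs1 : s ≠ 1)
    (hs0 : riemannZeta s ≠ 0) (hs2 : ¬ IsTrivialZetaZero s) :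
    iteratedDeriv k zetaLogDerivDeriv s =
      (-1) ^ k * ((k + 1).factorial : ℂ) *
        (1 / (s - 1) ^ (k + 2) -
          ∑' ρ : ℂ, (zeroMult riemannZeta ρ : ℂ) / (s - ρ) ^ (k + 2)) := by
  obtain ⟨C, hC⟩ := exists_hasGrowth_subOneMulZeta
  have hF := differentiable_subOneMulZeta
  have hFs : subOneMulZeta s ≠ 0 := by
    rw [subOneMulZeta_eq hs1]
    exact mul_ne_zero (sub_ne_zero.2 hs1) hs0
  have hev : (fun z => deriv riemannZeta z / riemannZeta z) =ᶠ[𝓝 s]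
      logDeriv subOneMulZeta - fun z => (z - 1)⁻¹ := by
    filter_upwards [isOpen_ne.mem_nhds hs1,
      (differentiableAt_riemannZeta hs1).continuousAt.eventually_ne hs0] with z hz1 hz0
    exact logDeriv_riemannZeta_eq hz1 hz0
  have h1 : ContDiffAt ℂ (k + 1 : ℕ) (logDeriv subOneMulZeta) s :=
    ((hF.analyticAt s).deriv.div (hF.analyticAt s) hFs).contDiffAt
  have h2 : ContDiffAt ℂ (k + 1 : ℕ) (fun z : ℂ => (z - 1)⁻¹) s :=
    (contDiffAt_id.sub contDiffAt_const).inv (sub_ne_zero.2 hs1)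
  rw [zetaLogDerivDeriv, ← iteratedDeriv_succ', hev.iteratedDeriv_eq, iteratedDeriv_sub h1 h2,
    hC.iteratedDeriv_logDeriv hF subOneMulZeta_zero_ne_zero k hFs, iteratedDeriv_inv_sub]
  simp only [zeroMult_riemannZeta]
  ring
end

section
/- For an integer k ≥ 0 and a complex number s with Re s ≥ 1, define Δ_k(s) = ∑_{p prime} ∑_{l=2}^{∞} (l^k − l^{k+1})·(log p)^{k+2}·p^{−ls} (an absolutely convergent double series). Then for every compact set S of real numbers with 0 ∉ S, lim_{k→∞} sup_{t∈S} |Δ_k(1+it)| / (2^k·(k+1)!) = 0. Consequently, with K(s) = ∑_n Λ(n)²/n^s and W(s) = (ζ'/ζ)'(s), one has K^{(k)}(s) − W^{(k)}(s) = (−1)^k Δ_k(s) for Re s > 1, and uniformly for t ∈ S, |K^{(k)}(1+it) − W^{(k)}(1+it)| = o(2^k (k+1)!) as k → ∞. -/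
open Complex

/-- `Δ_k(s) = ∑_p ∑_{l≥2} (l^k - l^{k+1}) (log p)^{k+2} p^{-ls}`. -/
noncomputable def DeltaK (k : ℕ) (s : ℂ) : ℂ :=
  ∑' p : Nat.Primes, ∑' l : ℕ,
    (((l + 2 : ℕ) : ℂ) ^ k - ((l + 2 : ℕ) : ℂ) ^ (k + 1)) *
      (Real.log (p : ℕ) : ℂ) ^ (k + 2) * ((p : ℕ) : ℂ) ^ (-(((l + 2 : ℕ) : ℂ)) * s)

/-- `K(s) = ∑_n Λ(n)²/n^s` for `Re s > 1`. -/
noncomputable def Kfun (s : ℂ) : ℂ :=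
  ∑' n : ℕ, (ArithmeticFunction.vonMangoldt n : ℂ) ^ 2 / (n : ℂ) ^ s

/-- The coefficients `c` grow at most polynomially. -/
def PolynomiallyBounded (c : ℕ → ℂ) : Prop :=
  ∃ C : ℝ, ∃ j : ℕ, ∀ l, ‖c l‖ ≤ C * (l + 1 : ℝ) ^ j

/-- The term `c_l (log p)^k p^{-(l+m)s}`. -/
noncomputable def primePowTerm (c : ℕ → ℂ) (k m : ℕ) (s : ℂ) (x : Nat.Primes × ℕ) : ℂ :=
  c x.2 * (Real.log (x.1 : ℕ) : ℂ) ^ k * ((x.1 : ℕ) : ℂ) ^ (-(((x.2 + m : ℕ) : ℂ)) * s)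

/-- The Dirichlet series `∑_p ∑_l c_l (log p)^k p^{-(l+m)s}` over prime powers. -/
noncomputable def primePowSeries (c : ℕ → ℂ) (k m : ℕ) (s : ℂ) : ℂ :=
  ∑' x : Nat.Primes × ℕ, primePowTerm c k m s x

lemma PolynomiallyBounded.mul {c d : ℕ → ℂ} (hc : PolynomiallyBounded c)
    (hd : PolynomiallyBounded d) : PolynomiallyBounded (fun l ↦ c l * d l) := by
  obtain ⟨C, i, hC⟩ := hc
  obtain ⟨D, j, hD⟩ := hd
  refine ⟨C * D, i + j, fun l ↦ ?_⟩
  calc ‖c l * d l‖ = ‖c l‖ * ‖d l‖ := norm_mul _ _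
    _ ≤ (C * (l + 1 : ℝ) ^ i) * (D * (l + 1 : ℝ) ^ j) :=
        mul_le_mul (hC l) (hD l) (norm_nonneg _) ((norm_nonneg _).trans (hC l))
    _ = _ := by ring

lemma PolynomiallyBounded.const (a : ℂ) : PolynomiallyBounded (fun _ ↦ a) :=
  ⟨‖a‖, 0, fun l ↦ by simp⟩

lemma PolynomiallyBounded.natCast_add (m : ℕ) :
    PolynomiallyBounded (fun l ↦ ((l + m : ℕ) : ℂ)) := by
  refine ⟨m + 1, 1, fun l ↦ ?_⟩
  rw [Complex.norm_natCast]
  push_cast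
  have : (0 : ℝ) ≤ l * m := by positivity
  nlinarith

lemma PolynomiallyBounded.neg {c : ℕ → ℂ} (hc : PolynomiallyBounded c) :
    PolynomiallyBounded (fun l ↦ -c l) := by
  simpa using (PolynomiallyBounded.const (-1)).mul hc

lemma PolynomiallyBounded.pow {c : ℕ → ℂ} (hc : PolynomiallyBounded c) (n : ℕ) :
    PolynomiallyBounded (fun l ↦ c l ^ n) := by
  induction n with
  | zero => simpa using PolynomiallyBounded.const 1
  | succ n ih => simpa only [pow_succ] using ih.mul hc

lemma PolynomiallyBounded.add {c d : ℕ → ℂ} (hc : PolynomiallyBounded c)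
    (hd : PolynomiallyBounded d) : PolynomiallyBounded (fun l ↦ c l + d l) := by
  obtain ⟨C, i, hC⟩ := hc
  obtain ⟨D, j, hD⟩ := hd
  have one_le (l : ℕ) : (1 : ℝ) ≤ l + 1 := by simp
  have hC0 : 0 ≤ C := by simpa using (norm_nonneg _).trans (hC 0)
  have hD0 : 0 ≤ D := by simpa using (norm_nonneg _).trans (hD 0)
  refine ⟨C + D, i + j, fun l ↦ ?_⟩
  calc ‖c l + d l‖ ≤ ‖c l‖ + ‖d l‖ := norm_add_le _ _
    _ ≤ C * (l + 1 : ℝ) ^ i + D * (l + 1 : ℝ) ^ j := add_le_add (hC l) (hD l)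
    _ ≤ C * (l + 1 : ℝ) ^ (i + j) + D * (l + 1 : ℝ) ^ (i + j) := by
        gcongr <;> first | exact one_le l | omega
    _ = _ := by ring

lemma summable_log_pow_mul_rpow_neg (k : ℕ) {a : ℝ} (ha : 1 < a) :
    Summable (fun n : ℕ ↦ Real.log n ^ k * (n : ℝ) ^ (-a)) := by
  have hpos : 0 < (a - 1) / 2 := by linarith
  have h1 : Summable (fun n : ℕ ↦ (n : ℝ) ^ (-((a + 1) / 2))) :=
    Real.summable_nat_rpow.mpr (by linarith)
  refine summable_of_isBigO_nat h1 ?_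
  have h2 := ((isLittleO_log_rpow_rpow_atTop (k : ℝ) hpos).isBigO.mul
    (Asymptotics.isBigO_refl (fun x : ℝ ↦ x ^ (-a)) Filter.atTop)).comp_tendsto
    tendsto_natCast_atTop_atTop
  refine h2.congr' ?_ ?_
  · filter_upwards with n
    simp
  · filter_upwards [Filter.eventually_gt_atTop 0] with n hn
    have hn' : (0 : ℝ) < n := by exact_mod_cast hn
    simp only [Function.comp]
    rw [← Real.rpow_add hn']
    congr 1
    ring

/-- Locally uniform summable bounds for the terms of `primePowSeries`. -/
lemma exists_summable_bound_primePowTerm {c : ℕ → ℂ} (hc : PolynomiallyBounded c) (k m : ℕ)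
    {a : ℝ} (ha : 1 < m * a) :
    ∃ u : Nat.Primes × ℕ → ℝ, Summable u ∧
      ∀ x (s : ℂ), a ≤ s.re → ‖primePowTerm c k m s x‖ ≤ u x := by
  obtain ⟨C, j, hC⟩ := hc
  have ha0 : 0 < a := by
    by_contra! h
    have : (m : ℝ) * a ≤ 0 := mul_nonpos_of_nonneg_of_nonpos (by positivity) h
    linarith
  have hC0 : 0 ≤ C := by simpa using (norm_nonneg _).trans (hC 0)
  set r : ℝ := (2 : ℝ) ^ (-a) with hr
  have hr0 : 0 < r := by positivity
  have hr1 : r < 1 := Real.rpow_lt_one_of_one_lt_of_neg (by norm_num) (by linarith)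
  have hs1 : Summable (fun p : Nat.Primes ↦
      Real.log (p : ℕ) ^ k * ((p : ℕ) : ℝ) ^ (-(m * a))) :=
    (summable_log_pow_mul_rpow_neg k ha).subtype _
  have hs2 : Summable (fun l : ℕ ↦ C * (l + 1 : ℝ) ^ j * r ^ l) := by
    have h := summable_pow_mul_geometric_of_norm_lt_one (R := ℝ) j (r := r)
      (by rwa [Real.norm_of_nonneg hr0.le])
    have h := ((summable_nat_add_iff 1).mpr h).mul_left (C * r⁻¹)
    refine h.congr fun l ↦ ?_
    push_cast
    field_simp
    ring
  refine ⟨_, hs1.mul_of_nonneg hs2 (fun p ↦ ?_) (fun l ↦ ?_), fun ⟨p, l⟩ s hs ↦ ?_⟩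
  · have := Real.log_natCast_nonneg (p : ℕ)
    simp only [Pi.zero_apply]
    positivity
  · simp only [Pi.zero_apply]
    positivity
  · have hp2 : (2 : ℝ) ≤ (p : ℕ) := by exact_mod_cast p.prop.two_le
    have hp0 : (0 : ℝ) < (p : ℕ) := by linarith
    have hlog := Real.log_natCast_nonneg (p : ℕ)
    have hcpow : ‖((p : ℕ) : ℂ) ^ (-((l + m : ℕ) : ℂ) * s)‖
        ≤ r ^ l * ((p : ℕ) : ℝ) ^ (-(m * a)) := by
      rw [Complex.norm_natCast_cpow_of_pos p.prop.pos]
      have hre : (-((l + m : ℕ) : ℂ) * s).re = -((l + m : ℕ) : ℝ) * s.re := by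
        simp [Complex.mul_re]
      rw [hre]
      calc ((p : ℕ) : ℝ) ^ (-((l + m : ℕ) : ℝ) * s.re)
          ≤ ((p : ℕ) : ℝ) ^ (-(l * a) + -(m * a)) := by
            apply Real.rpow_le_rpow_of_exponent_le (by linarith)
            have : ((l + m : ℕ) : ℝ) * a ≤ ((l + m : ℕ) : ℝ) * s.re := by gcongr
            push_cast at this ⊢
            linarith
        _ = ((p : ℕ) : ℝ) ^ (-(l * a)) * ((p : ℕ) : ℝ) ^ (-(m * a)) := Real.rpow_add hp0 _ _
        _ ≤ (2 : ℝ) ^ (-(l * a)) * ((p : ℕ) : ℝ) ^ (-(m * a)) := by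
            gcongr ?_ * _
            exact Real.rpow_le_rpow_of_nonpos (by norm_num) hp2
              (neg_nonpos.mpr (by positivity))
        _ = _ := by
            rw [hr, ← Real.rpow_natCast, ← Real.rpow_mul (by norm_num)]
            congr 2
            ring
    simp only [primePowTerm, norm_mul, norm_pow, Complex.norm_real, Real.norm_of_nonneg hlog]
    calc ‖c l‖ * Real.log (p : ℕ) ^ k * ‖((p : ℕ) : ℂ) ^ (-((l + m : ℕ) : ℂ) * s)‖
        ≤ (C * (l + 1 : ℝ) ^ j) * Real.log (p : ℕ) ^ k *
            (r ^ l * ((p : ℕ) : ℝ) ^ (-(m * a))) := by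
          gcongr
          exact hC l
      _ = _ := by ring

lemma exists_lt_re_of_one_lt {m : ℕ} {s : ℂ} (hs : 1 < m * s.re) :
    ∃ a : ℝ, 1 < m * a ∧ a < s.re := by
  have hm : (0 : ℝ) < m := by
    rcases Nat.eq_zero_or_pos m with rfl | h
    · norm_num at hs
    · exact_mod_cast h
  obtain ⟨a, h1, h2⟩ := exists_between ((div_lt_iff₀' hm).mpr hs)
  exact ⟨a, (div_lt_iff₀' hm).mp h1, h2⟩

lemma summable_primePowTerm {c : ℕ → ℂ} (hc : PolynomiallyBounded c) (k : ℕ) {m : ℕ}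
    {s : ℂ} (hs : 1 < m * s.re) : Summable (primePowTerm c k m s) := by
  obtain ⟨u, hu, h⟩ := exists_summable_bound_primePowTerm hc k m hs
  exact Summable.of_norm_bounded hu fun x ↦ h x s le_rfl

lemma hasDerivAt_primePowSeries {c : ℕ → ℂ} (hc : PolynomiallyBounded c) (k : ℕ) {m : ℕ}
    {s : ℂ} (hs : 1 < m * s.re) :
    HasDerivAt (primePowSeries c k m)
      (primePowSeries (fun l ↦ -((l + m : ℕ) : ℂ) * c l) (k + 1) m s) s := by
  obtain ⟨a, ha, has⟩ := exists_lt_re_of_one_lt hs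
  obtain ⟨u, hu, h⟩ := exists_summable_bound_primePowTerm
    ((PolynomiallyBounded.natCast_add m).neg.mul hc) (k + 1) m ha
  have hopen : IsOpen {z : ℂ | a < z.re} := isOpen_lt continuous_const Complex.continuous_re
  refine hasDerivAt_tsum_of_isPreconnected (t := {z : ℂ | a < z.re}) hu hopen
    (convex_halfSpace_re_gt a).isPreconnected (g := fun x z ↦ primePowTerm c k m z x)
    (fun ⟨p, l⟩ z _ ↦ ?_) (fun x z hz ↦ h x z (le_of_lt hz)) has
    (summable_primePowTerm hc k hs) has
  have hp : ((p : ℕ) : ℂ) ≠ 0 := by exact_mod_cast p.prop.ne_zero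
  have h1 : HasDerivAt (fun z : ℂ ↦ -((l + m : ℕ) : ℂ) * z) (-((l + m : ℕ) : ℂ)) z := by
    simpa using (hasDerivAt_id z).const_mul (-((l + m : ℕ) : ℂ))
  refine ((h1.const_cpow (c := ((p : ℕ) : ℂ)) (Or.inl hp)).const_mul
    (c l * (Real.log (p : ℕ) : ℂ) ^ k)).congr_deriv ?_
  simp only [primePowTerm, Complex.natCast_log]
  ring

lemma eventually_one_lt_mul_re {m : ℕ} {s : ℂ} (hs : 1 < m * s.re) :
    ∀ᶠ z : ℂ in nhds s, 1 < m * z.re :=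
  (isOpen_lt continuous_const (continuous_const.mul Complex.continuous_re)).mem_nhds hs

lemma iteratedDeriv_primePowSeries {c : ℕ → ℂ} (hc : PolynomiallyBounded c) (k : ℕ) {m : ℕ}
    (n : ℕ) {s : ℂ} (hs : 1 < m * s.re) :
    iteratedDeriv n (primePowSeries c k m) s =
      primePowSeries (fun l ↦ (-((l + m : ℕ) : ℂ)) ^ n * c l) (k + n) m s := by
  induction n generalizing s with
  | zero => simp
  | succ n ih =>
    rw [iteratedDeriv_succ]
    have h : iteratedDeriv n (primePowSeries c k m) =ᶠ[nhds s]
        primePowSeries (fun l ↦ (-((l + m : ℕ) : ℂ)) ^ n * c l) (k + n) m := by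
      filter_upwards [eventually_one_lt_mul_re hs] with z hz using ih hz
    rw [h.deriv_eq, (hasDerivAt_primePowSeries
      (((PolynomiallyBounded.natCast_add m).neg.pow n).mul hc) (k + n) hs).deriv]
    simp only [pow_succ', mul_assoc, add_assoc]

lemma primePowSeries_eq_of_apply_zero {c : ℕ → ℂ} (hc : c 0 = 0) (k m : ℕ) (s : ℂ) :
    primePowSeries c k m s = primePowSeries (fun l ↦ c (l + 1)) k (m + 1) s := by
  have hinj : Function.Injective (fun x : Nat.Primes × ℕ ↦ (x.1, x.2 + 1)) := by
    rintro ⟨p, l⟩ ⟨q, n⟩ h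
    simpa using h
  have hsupp : Function.support (primePowTerm c k m s) ⊆
      Set.range (fun x : Nat.Primes × ℕ ↦ (x.1, x.2 + 1)) := by
    rintro ⟨p, l⟩ hx
    rcases l with _ | l
    · exact absurd (by simp [primePowTerm, hc]) hx
    · exact ⟨(p, l), rfl⟩
  rw [primePowSeries, ← hinj.tsum_eq hsupp, primePowSeries]
  refine tsum_congr fun x ↦ ?_
  simp only [primePowTerm]
  rw [show x.2 + 1 + m = x.2 + (m + 1) by ring]

lemma primePowSeries_add {c d : ℕ → ℂ} (hc : PolynomiallyBounded c) (hd : PolynomiallyBounded d)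
    (k : ℕ) {m : ℕ} {s : ℂ} (hs : 1 < m * s.re) :
    primePowSeries (fun l ↦ c l + d l) k m s =
      primePowSeries c k m s + primePowSeries d k m s := by
  simp only [primePowSeries]
  rw [← (summable_primePowTerm hc k hs).tsum_add (summable_primePowTerm hd k hs)]
  refine tsum_congr fun x ↦ ?_
  simp only [primePowTerm]
  ring

lemma primePowSeries_const_mul (a : ℂ) (c : ℕ → ℂ) (k m : ℕ) (s : ℂ) :
    primePowSeries (fun l ↦ a * c l) k m s = a * primePowSeries c k m s := by
  simp only [primePowSeries]
  rw [← tsum_mul_left]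
  refine tsum_congr fun x ↦ ?_
  simp only [primePowTerm]
  ring

lemma PolynomiallyBounded.single : PolynomiallyBounded (Pi.single 0 1) := by
  refine ⟨1, 0, fun l ↦ ?_⟩
  rcases l with _ | l <;> simp

lemma primePowSeries_eq_single_add {c : ℕ → ℂ} (hc : PolynomiallyBounded c)
    (k : ℕ) {m : ℕ} {s : ℂ} (hs : 1 < m * s.re) :
    primePowSeries c k m s = c 0 * primePowSeries (Pi.single 0 1) k m s +
      primePowSeries (fun l ↦ c (l + 1)) k (m + 1) s := by
  have h1 : PolynomiallyBounded (fun l ↦ c 0 * (Pi.single 0 1 : ℕ → ℂ) l) :=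
    (PolynomiallyBounded.const (c 0)).mul .single
  have h2 : PolynomiallyBounded (fun l ↦ c l + -(c 0 * (Pi.single 0 1 : ℕ → ℂ) l)) :=
    hc.add h1.neg
  have h3 := primePowSeries_eq_of_apply_zero
    (c := fun l ↦ c l + -(c 0 * (Pi.single 0 1 : ℕ → ℂ) l)) (by simp) k m s
  have h4 := primePowSeries_add h1 h2 k hs
  simp only [add_neg_cancel_comm_assoc] at h4
  rw [h4, h3, primePowSeries_const_mul]
  simp

lemma primePowSeries_single_two (k : ℕ) (s : ℂ) :
    primePowSeries (Pi.single 0 1) k 1 (2 * s) = primePowSeries (Pi.single 0 1) k 2 s := by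
  rw [primePowSeries, primePowSeries]
  refine tsum_congr fun ⟨p, l⟩ ↦ ?_
  rcases l with _ | l <;> simp [primePowTerm]

lemma DeltaK_eq_primePowSeries (k : ℕ) {s : ℂ} (hs : 1 < 2 * s.re) :
    DeltaK k s = primePowSeries
      (fun l ↦ ((l + 2 : ℕ) : ℂ) ^ k - ((l + 2 : ℕ) : ℂ) ^ (k + 1)) (k + 2) 2 s := by
  have hc : PolynomiallyBounded
      (fun l ↦ ((l + 2 : ℕ) : ℂ) ^ k - ((l + 2 : ℕ) : ℂ) ^ (k + 1)) := by
    simp only [sub_eq_add_neg]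
    exact ((PolynomiallyBounded.natCast_add 2).pow k).add
      ((PolynomiallyBounded.natCast_add 2).pow (k + 1)).neg
  exact (summable_primePowTerm hc (k + 2) (by exact_mod_cast hs)).tsum_prod.symm

lemma tsum_eq_primePowSeries_of_support {g : ℕ → ℂ} (hg : ∀ n, ¬ IsPrimePow n → g n = 0)
    (k : ℕ) (hg' : ∀ (p : Nat.Primes) (l : ℕ), g (p ^ (l + 1)) = (Real.log (p : ℕ) : ℂ) ^ k)
    (s : ℂ) :
    ∑' n : ℕ, g n / (n : ℂ) ^ s = primePowSeries (fun _ ↦ 1) k 1 s := by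
  have hinj : Function.Injective (fun x : Nat.Primes × ℕ ↦ (Nat.Primes.prodNatEquiv x : ℕ)) :=
    Subtype.val_injective.comp Nat.Primes.prodNatEquiv.injective
  have hsupp : Function.support (fun n : ℕ ↦ g n / (n : ℂ) ^ s) ⊆
      Set.range (fun x : Nat.Primes × ℕ ↦ (Nat.Primes.prodNatEquiv x : ℕ)) := by
    intro n hn
    have hpp : IsPrimePow n := by
      by_contra h
      exact hn (by simp [hg n h])
    exact ⟨Nat.Primes.prodNatEquiv.symm ⟨n, hpp⟩, by simp only [Equiv.apply_symm_apply]⟩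
  rw [← hinj.tsum_eq hsupp, primePowSeries]
  refine tsum_congr fun ⟨p, l⟩ ↦ ?_
  simp only [Nat.Primes.coe_prodNatEquiv_apply, hg', primePowTerm, one_mul]
  rw [neg_mul, Complex.cpow_neg, div_eq_mul_inv, Complex.natCast_cpow_natCast_mul, Nat.cast_pow]

lemma vonMangoldt_prime_pow (p : Nat.Primes) (l : ℕ) :
    ArithmeticFunction.vonMangoldt ((p : ℕ) ^ (l + 1)) = Real.log (p : ℕ) := by
  rw [ArithmeticFunction.vonMangoldt_apply_pow l.succ_ne_zero,
    ArithmeticFunction.vonMangoldt_apply_prime p.prop]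

lemma Kfun_eq_primePowSeries : Kfun = primePowSeries (fun _ ↦ 1) 2 1 := by
  funext s
  refine tsum_eq_primePowSeries_of_support
    (g := fun n ↦ (ArithmeticFunction.vonMangoldt n : ℂ) ^ 2) (fun n hn ↦ ?_) 2
    (fun p l ↦ ?_) s
  · simp [ArithmeticFunction.vonMangoldt_eq_zero_iff.mpr hn]
  · simp only [vonMangoldt_prime_pow]

lemma logDeriv_riemannZeta_eq_neg_primePowSeries {s : ℂ} (hs : 1 < s.re) :
    deriv riemannZeta s / riemannZeta s = -primePowSeries (fun _ ↦ 1) 1 1 s := by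
  have hs0 : s ≠ 0 := by
    rintro rfl
    norm_num at hs
  rw [← neg_eq_iff_eq_neg, ← neg_div,
    ← ArithmeticFunction.LSeries_vonMangoldt_eq_deriv_riemannZeta_div hs, LSeries]
  simp only [LSeries.term_of_ne_zero' hs0]
  refine tsum_eq_primePowSeries_of_support (fun n hn ↦ ?_) 1 (fun p l ↦ ?_) s
  · simp [ArithmeticFunction.vonMangoldt_eq_zero_iff.mpr hn]
  · simp only [vonMangoldt_prime_pow, pow_one]

lemma zetaLogDerivDeriv_eq_primePowSeries {s : ℂ} (hs : 1 < s.re) :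
    zetaLogDerivDeriv s = primePowSeries (fun l ↦ ((l + 1 : ℕ) : ℂ)) 2 1 s := by
  have h : (fun z ↦ deriv riemannZeta z / riemannZeta z) =ᶠ[nhds s]
      fun z ↦ -primePowSeries (fun _ ↦ 1) 1 1 z := by
    filter_upwards [(isOpen_lt continuous_const Complex.continuous_re).mem_nhds hs] with z hz
    exact logDeriv_riemannZeta_eq_neg_primePowSeries hz
  have hd := hasDerivAt_primePowSeries (.const 1) 1 (m := 1) (s := s) (by simpa using hs)
  rw [zetaLogDerivDeriv, h.deriv_eq, hd.fun_neg.deriv, ← neg_one_mul, ← primePowSeries_const_mul]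
  simp

lemma iteratedDeriv_Kfun_sub_iteratedDeriv_zetaLogDerivDeriv (k : ℕ) {s : ℂ} (hs : 1 < s.re) :
    iteratedDeriv k Kfun s - iteratedDeriv k zetaLogDerivDeriv s = (-1) ^ k * DeltaK k s := by
  have hs1 : 1 < ((1 : ℕ) : ℝ) * s.re := by simpa using hs
  have hpow := (PolynomiallyBounded.natCast_add 1).neg.pow k
  have hW : zetaLogDerivDeriv =ᶠ[nhds s] primePowSeries (fun l ↦ ((l + 1 : ℕ) : ℂ)) 2 1 := by
    filter_upwards [(isOpen_lt continuous_const Complex.continuous_re).mem_nhds hs] with z hz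
    exact zetaLogDerivDeriv_eq_primePowSeries hz
  rw [hW.iteratedDeriv_eq, Kfun_eq_primePowSeries, iteratedDeriv_primePowSeries (.const 1) _ _ hs1,
    iteratedDeriv_primePowSeries (.natCast_add 1) _ _ hs1, sub_eq_add_neg, ← neg_one_mul,
    ← primePowSeries_const_mul, ← primePowSeries_add (hpow.mul (.const 1))
      ((PolynomiallyBounded.const (-1)).mul (hpow.mul (.natCast_add 1))) _ hs1,
    primePowSeries_eq_of_apply_zero (by simp), DeltaK_eq_primePowSeries k (by linarith),
    ← primePowSeries_const_mul, add_comm 2 k]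
  congr 1
  funext l
  rw [show l + 1 + 1 = l + 2 from rfl, neg_pow]
  ring

/-- A formula for `DeltaK 0` that continues it analytically to the line `Re s = 1 / 2`. -/
noncomputable def DeltaKContinuation (s : ℂ) : ℂ :=
  -zetaLogDerivDeriv (2 * s) + primePowSeries (fun l ↦ ((l + 2 : ℕ) : ℂ)) 2 2 (2 * s) +
    primePowSeries (fun l ↦ 1 + -((l + 3 : ℕ) : ℂ)) 2 3 s

lemma primePowSeries_eq_DeltaKContinuation {s : ℂ} (hs : 1 < 2 * s.re) :
    primePowSeries (fun l ↦ 1 + -((l + 2 : ℕ) : ℂ)) 2 2 s = DeltaKContinuation s := by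
  have hre : (2 * s).re = 2 * s.re := by simp
  rw [DeltaKContinuation, zetaLogDerivDeriv_eq_primePowSeries (by rwa [hre]),
    primePowSeries_eq_single_add (.natCast_add 1) 2 (s := 2 * s) (by simpa [hre] using hs),
    primePowSeries_single_two,
    primePowSeries_eq_single_add ((PolynomiallyBounded.const 1).add
      (PolynomiallyBounded.natCast_add 2).neg) 2 (by exact_mod_cast hs)]
  simp only [add_assoc, Nat.reduceAdd]
  push_cast
  ring

lemma differentiableAt_zetaLogDerivDeriv {s : ℂ} (hs : 1 ≤ s.re) (hs1 : s ≠ 1) :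
    DifferentiableAt ℂ zetaLogDerivDeriv s := by
  have hzeta : AnalyticAt ℂ riemannZeta s := by
    refine DifferentiableOn.analyticAt (s := {1}ᶜ) (fun z hz ↦ ?_)
      (isOpen_compl_singleton.mem_nhds hs1)
    exact (differentiableAt_riemannZeta hz).differentiableWithinAt
  exact (hzeta.deriv.fun_div hzeta (riemannZeta_ne_zero_of_one_le_re hs)).deriv.differentiableAt

lemma differentiableAt_DeltaKContinuation {s : ℂ} (hs : 1 / 2 ≤ s.re) (hs1 : s ≠ 1 / 2) :
    DifferentiableAt ℂ DeltaKContinuation s := by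
  have hre : (2 * s).re = 2 * s.re := by simp
  have hlin : DifferentiableAt ℂ (fun z : ℂ ↦ 2 * z) s := by fun_prop
  have h1 : DifferentiableAt ℂ (fun z ↦ zetaLogDerivDeriv (2 * z)) s := by
    refine DifferentiableAt.comp s (differentiableAt_zetaLogDerivDeriv ?_ fun h ↦ hs1 ?_) hlin
    · rw [hre]
      linarith
    · rw [← h]
      ring
  have h2 : DifferentiableAt ℂ
      (fun z ↦ primePowSeries (fun l ↦ ((l + 2 : ℕ) : ℂ)) 2 2 (2 * z)) s := by
    refine DifferentiableAt.comp s (hasDerivAt_primePowSeries (.natCast_add 2) 2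
      ?_).differentiableAt hlin
    rw [hre]
    push_cast
    linarith
  have h3 : DifferentiableAt ℂ (primePowSeries (fun l ↦ 1 + -((l + 3 : ℕ) : ℂ)) 2 3) s := by
    refine (hasDerivAt_primePowSeries ((PolynomiallyBounded.const 1).add
      (PolynomiallyBounded.natCast_add 3).neg) 2 ?_).differentiableAt
    push_cast
    linarith
  exact (h1.neg.add h2).add h3

lemma norm_DeltaK_eq_norm_iteratedDeriv (k : ℕ) {s : ℂ} (hs : 1 < 2 * s.re) :
    ‖DeltaK k s‖ = ‖iteratedDeriv k DeltaKContinuation s‖ := by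
  have hs2 : 1 < ((2 : ℕ) : ℝ) * s.re := by exact_mod_cast hs
  have h : DeltaKContinuation =ᶠ[nhds s]
      primePowSeries (fun l ↦ 1 + -((l + 2 : ℕ) : ℂ)) 2 2 := by
    filter_upwards [eventually_one_lt_mul_re hs2] with z hz
    exact (primePowSeries_eq_DeltaKContinuation (by exact_mod_cast hz)).symm
  have hsign : primePowSeries (fun l ↦ (-((l + 2 : ℕ) : ℂ)) ^ k * (1 + -((l + 2 : ℕ) : ℂ)))
      (2 + k) 2 s = (-1) ^ k * DeltaK k s := by
    rw [DeltaK_eq_primePowSeries k hs, ← primePowSeries_const_mul, add_comm 2 k]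
    congr 1
    funext l
    rw [neg_pow]
    ring
  rw [h.iteratedDeriv_eq, iteratedDeriv_primePowSeries ((PolynomiallyBounded.const 1).add
    (PolynomiallyBounded.natCast_add 2).neg) _ _ hs2, hsign]
  simp

lemma half_le_re_and_ne_half_of_mem_closedBall {t : ℝ} (ht : t ≠ 0) {z : ℂ}
    (hz : z ∈ Metric.closedBall (1 + t * Complex.I) (1 / 2)) : 1 / 2 ≤ z.re ∧ z ≠ 1 / 2 := by
  rw [Metric.mem_closedBall, dist_eq_norm] at hz
  constructor
  · have h := (Complex.abs_re_le_norm _).trans hz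
    simp only [Complex.sub_re, Complex.add_re, Complex.one_re, Complex.re_ofReal_mul,
      Complex.I_re, mul_zero, add_zero] at h
    linarith [(abs_le.mp h).1]
  · rintro rfl
    have h : ‖(1 / 2 : ℂ) - (1 + t * Complex.I)‖ ^ 2 ≤ (1 / 2) ^ 2 := by gcongr
    rw [← Complex.normSq_eq_norm_sq, Complex.normSq_apply] at h
    norm_num at h
    exact ht (by nlinarith [sq_nonneg t])

lemma exists_norm_DeltaKContinuation_le {S : Set ℝ} (hS : IsCompact S) (h0 : (0 : ℝ) ∉ S) :
    ∃ M : ℝ, ∀ t ∈ S, ∀ z ∈ Metric.closedBall (1 + t * Complex.I) (1 / 2),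
      ‖DeltaKContinuation z‖ ≤ M := by
  have hcomp : IsCompact ((fun x : ℝ × ℂ ↦ 1 + x.1 * Complex.I + x.2) ''
      (S ×ˢ Metric.closedBall (0 : ℂ) (1 / 2))) :=
    (hS.prod (isCompact_closedBall _ _)).image (by fun_prop)
  have hmem {t : ℝ} {z : ℂ} : z ∈ Metric.closedBall (0 : ℂ) (1 / 2) ↔
      1 + t * Complex.I + z ∈ Metric.closedBall (1 + t * Complex.I) (1 / 2) := by
    simp [dist_eq_norm]
  obtain ⟨M, hM⟩ := hcomp.exists_bound_of_continuousOn (f := DeltaKContinuation) (by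
    rintro _ ⟨⟨t, z⟩, ⟨ht, hz⟩, rfl⟩
    have ht0 : t ≠ 0 := fun h ↦ h0 (h ▸ ht)
    obtain ⟨h1, h2⟩ := half_le_re_and_ne_half_of_mem_closedBall ht0 (hmem.mp hz)
    exact (differentiableAt_DeltaKContinuation h1 h2).continuousAt.continuousWithinAt)
  refine ⟨M, fun t ht z hz ↦ hM z ⟨(t, z - (1 + t * Complex.I)), ⟨ht, ?_⟩, by simp⟩⟩
  rw [hmem (t := t)]
  simpa using hz

/-- For every compact `S ⊆ ℝ` not containing `0`,
`sup_{t∈S} |Δ_k(1+it)|/(2^k (k+1)!) → 0` as `k → ∞`; moreover for `Re s > 1`,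
`K^{(k)}(s) - W^{(k)}(s) = (-1)^k Δ_k(s)` (so that, by analytic continuation to the line
`Re s = 1`, `|K^{(k)}(1+it) - W^{(k)}(1+it)| = o(2^k (k+1)!)` uniformly on `S`). -/
theorem DeltaK_little_o :
    (∀ S : Set ℝ, IsCompact S → (0 : ℝ) ∉ S → ∀ ε : ℝ, 0 < ε → ∃ N : ℕ, ∀ k : ℕ, N ≤ k →
      ∀ t ∈ S, ‖DeltaK k (1 + t * Complex.I)‖ ≤ ε * (2 ^ k * ((k + 1).factorial : ℝ))) ∧
    (∀ k : ℕ, ∀ s : ℂ, 1 < s.re →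
      iteratedDeriv k Kfun s - iteratedDeriv k zetaLogDerivDeriv s = (-1) ^ k * DeltaK k s) := by
  refine ⟨fun S hS h0 ε hε ↦ ?_,
    fun k s hs ↦ iteratedDeriv_Kfun_sub_iteratedDeriv_zetaLogDerivDeriv k hs⟩
  obtain ⟨M, hM⟩ := exists_norm_DeltaKContinuation_le hS h0
  obtain ⟨N, hN⟩ := exists_nat_ge (M / ε)
  refine ⟨N, fun k hk t ht ↦ ?_⟩
  have ht0 : t ≠ 0 := fun h ↦ h0 (h ▸ ht)
  have hdiff : DifferentiableOn ℂ DeltaKContinuation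
      (Metric.closedBall (1 + t * Complex.I) (1 / 2)) := fun z hz ↦
    have h := half_le_re_and_ne_half_of_mem_closedBall ht0 hz
    (differentiableAt_DeltaKContinuation h.1 h.2).differentiableWithinAt
  have hcauchy := Complex.norm_iteratedDeriv_le_of_forall_mem_sphere_norm_le k
    (by norm_num : (0 : ℝ) < 1 / 2) (hdiff.diffContOnCl_ball subset_rfl)
    (fun z hz ↦ hM t ht z (Metric.sphere_subset_closedBall hz))
  have hMk : M ≤ ε * (k + 1) := by
    have h1 : M / ε ≤ k + 1 := hN.trans (by exact_mod_cast hk.trans k.le_succ)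
    rwa [div_le_iff₀' hε] at h1
  rw [norm_DeltaK_eq_norm_iteratedDeriv k (by simp)]
  calc _ ≤ (k.factorial : ℝ) * M / (1 / 2) ^ k := hcauchy
    _ = 2 ^ k * k.factorial * M := by
        rw [one_div, inv_pow, div_inv_eq_mul]
        ring
    _ ≤ 2 ^ k * k.factorial * (ε * (k + 1)) := by gcongr
    _ = _ := by
        rw [Nat.factorial_succ]
        push_cast
        ring
end
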